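/- arXiv:2204.07798 — 2 statements merged into one kernel-verified Lean document; each statement's English description precedes it below -/
import Mathlib

section
/- Let p, q, r ≥ 0 and p', q', r' ≥ 0 be integers, with at most one of p, q, r equal to 0 and at most one of p', q', r' equal to 0. If the graphs θ(p,q,r) and θ(p',q',r') have the same signless Laplacian permanental polynomial, i.e., per(xI − Q(θ(p,q,r))) = per(xI − Q(θ(p',q',r'))) as polynomials in x, then θ(p,q,r) is isomorphic to θ(p',q',r') (equivalently, {p,q,r} = {p',q',r'} as multisets). -/
open scoped Classical
open Polynomial

noncomputable section

/-- The signless Laplacian matrix `Q(G) = D(G) + A(G)` of a graph `G`. -/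
def signlessLapMatrix {V : Type*} [Fintype V] (G : SimpleGraph V) : Matrix V V ℚ :=
  G.degMatrix ℚ + G.adjMatrix ℚ

/-- The signless Laplacian permanental polynomial `per(x·I − Q(G))` of a graph `G`. -/
def qPermPoly {V : Type*} [Fintype V] (G : SimpleGraph V) : Polynomial ℚ :=
  Matrix.permanent
    (Matrix.diagonal (fun _ : V => (X : Polynomial ℚ)) - (signlessLapMatrix G).map Polynomial.C)

/-- The bicyclic graph `θ(p,q,r)` on `p + q + r + 2` vertices: the two hub vertices `0`
and `1` are joined by three internally disjoint paths having `p`, `q` and `r` internal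
vertices respectively (internal vertices `2, …, p+1`, then `p+2, …, p+q+1`, then
`p+q+2, …, p+q+r+1`); a path with `0` internal vertices is the edge `{0, 1}`. -/
def thetaGraph (p q r : ℕ) : SimpleGraph (Fin (p + q + r + 2)) :=
  SimpleGraph.fromRel (fun i j =>
    (p = 0 ∧ i.val = 0 ∧ j.val = 1) ∨
    (0 < p ∧ i.val = 0 ∧ j.val = 2) ∨
    (2 ≤ i.val ∧ i.val + 1 = j.val ∧ j.val < p + 2) ∨
    (0 < p ∧ i.val = p + 1 ∧ j.val = 1) ∨
    (q = 0 ∧ i.val = 0 ∧ j.val = 1) ∨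
    (0 < q ∧ i.val = 0 ∧ j.val = p + 2) ∨
    (p + 2 ≤ i.val ∧ i.val + 1 = j.val ∧ j.val < p + q + 2) ∨
    (0 < q ∧ i.val = p + q + 1 ∧ j.val = 1) ∨
    (r = 0 ∧ i.val = 0 ∧ j.val = 1) ∨
    (0 < r ∧ i.val = 0 ∧ j.val = p + q + 2) ∨
    (p + q + 2 ≤ i.val ∧ i.val + 1 = j.val) ∨
    (0 < r ∧ i.val = p + q + r + 1 ∧ j.val = 1))


/-! ### Permanents of matrices indexed by natural numbers -/

set_option linter.unusedSimpArgs false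

section PermanentTools

variable {R : Type*} [CommRing R]

/-- Permanent of the leading `n × n` block of an infinite matrix. -/
def perN (n : ℕ) (N : ℕ → ℕ → R) : R :=
  ∑ σ : Equiv.Perm (Fin n), ∏ j : Fin n, N (σ j) j

/-- Basis row vector. -/
def eRow (k : ℕ) : ℕ → R := fun j => if j = k then 1 else 0

theorem perN_congr {n : ℕ} {N N' : ℕ → ℕ → R} (h : ∀ i j, i < n → j < n → N i j = N' i j) :
    perN n N = perN n N' := by
  unfold perN
  refine Finset.sum_congr rfl fun σ _ => Finset.prod_congr rfl fun j _ => ?_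
  exact h _ _ (σ j).2 j.2

theorem perN_update_split (n : ℕ) (N : ℕ → ℕ → R) (i : ℕ) (hi : i < n) (r : ℕ → R) :
    perN n (Function.update N i r) = ∑ σ : Equiv.Perm (Fin n),
      r (σ.symm ⟨i, hi⟩) * ∏ j ∈ Finset.univ.erase (σ.symm ⟨i, hi⟩), N (σ j) j := by
  unfold perN
  refine Finset.sum_congr rfl fun σ _ => ?_
  rw [← Finset.mul_prod_erase _ _ (Finset.mem_univ (σ.symm ⟨i, hi⟩))]
  congr 1
  · simp
  · refine Finset.prod_congr rfl fun j hj => ?_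
    rw [Function.update_of_ne]
    intro h
    apply Finset.ne_of_mem_erase hj
    rw [Equiv.eq_symm_apply]
    exact Fin.ext h

theorem perN_update_add (n : ℕ) (N : ℕ → ℕ → R) (i : ℕ) (hi : i < n) (r s : ℕ → R) (a : R) :
    perN n (Function.update N i (fun j => r j + a * s j)) =
      perN n (Function.update N i r) + a * perN n (Function.update N i s) := by
  rw [perN_update_split n N i hi, perN_update_split n N i hi, perN_update_split n N i hi,
    Finset.mul_sum, ← Finset.sum_add_distrib]
  refine Finset.sum_congr rfl fun σ _ => ?_
  ring

theorem perN_zero_row (n : ℕ) (N : ℕ → ℕ → R) (i : ℕ) (hi : i < n)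
    (h : ∀ j, j < n → N i j = 0) : perN n N = 0 := by
  unfold perN
  refine Finset.sum_eq_zero fun σ _ => ?_
  refine Finset.prod_eq_zero (Finset.mem_univ (σ.symm ⟨i, hi⟩)) ?_
  simpa using h _ (σ.symm ⟨i, hi⟩).2

theorem perN_update_smul (n : ℕ) (N : ℕ → ℕ → R) (i : ℕ) (hi : i < n) (s : ℕ → R) (a : R) :
    perN n (Function.update N i (fun j => a * s j)) =
      a * perN n (Function.update N i s) := by
  rw [perN_update_split n N i hi, perN_update_split n N i hi, Finset.mul_sum]
  refine Finset.sum_congr rfl fun σ _ => ?_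
  ring

theorem perN_succ (n : ℕ) (N : ℕ → ℕ → R) :
    perN (n + 1) N = N n n * perN n N +
      ∑ i : Fin n, N i n * perN n (Function.update N i (N n)) := by
  unfold perN
  rw [← (Equiv.permCongr (finSuccEquivLast (n := n)).symm).sum_comp,
    ← Equiv.Perm.decomposeOption.symm.sum_comp, Fintype.sum_prod_type, Fintype.sum_option]
  congr 1
  · rw [Finset.mul_sum]
    refine Finset.sum_congr rfl fun σ _ => ?_
    rw [Fin.prod_univ_castSucc]
    simp [Equiv.permCongr_apply, mul_comm]
  · refine Finset.sum_congr rfl fun i _ => ?_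
    rw [Finset.mul_sum]
    refine Finset.sum_congr rfl fun σ _ => ?_
    rw [Fin.prod_univ_castSucc, mul_comm]
    congr 1
    · simp [Equiv.permCongr_apply]
    · refine Finset.prod_congr rfl fun j _ => ?_
      by_cases hj : σ j = i
      · subst hj
        simp [Equiv.permCongr_apply]
      · have h1 : (σ j : ℕ) ≠ i := fun h => hj (Fin.ext h)
        rw [Function.update_of_ne h1]
        simp [Equiv.permCongr_apply, Equiv.swap_apply_def, hj]

end PermanentTools

/-! ### Attaching a path between two vertices -/

section Gadget

variable {R : Type*} [CommRing R]

theorem perN_swap (n : ℕ) (N : ℕ → ℕ → R) (u v : ℕ) (hu : u < n) (hv : v < n) :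
    perN n (fun i => N (Equiv.swap u v i)) = perN n N := by
  unfold perN
  rw [← Equiv.sum_comp (Equiv.mulLeft (Equiv.swap (⟨u, hu⟩ : Fin n) ⟨v, hv⟩))
    (fun σ : Equiv.Perm (Fin n) => ∏ j : Fin n, N (σ j) j)]
  refine Finset.sum_congr rfl fun σ _ => Finset.prod_congr rfl fun j _ => ?_
  simp only [Equiv.coe_mulLeft, Equiv.Perm.mul_apply, Equiv.swap_apply_def, Fin.ext_iff]
  split_ifs <;> simp_all

theorem perN_succ_col (m : ℕ) (N : ℕ → ℕ → R) (u : ℕ) (hu : u < m)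
    (h : ∀ i, i < m → i ≠ u → N i m = 0) :
    perN (m + 1) N = N m m * perN m N + N u m * perN m (Function.update N u (N m)) := by
  rw [perN_succ]
  congr 1
  rw [Finset.sum_eq_single (⟨u, hu⟩ : Fin m)]
  · intro i _ hi
    rw [h i i.2 (fun h' => hi (Fin.ext h')), zero_mul]
  · simp

theorem perN_succ_row (m : ℕ) (N : ℕ → ℕ → R) (v : ℕ) (hv : v < m)
    (h : ∀ j, j < m → N v j = 0) :
    perN (m + 1) N = N v m * perN m (Function.update N v (N m)) := by
  rw [perN_succ, perN_zero_row m N v hv h, mul_zero, zero_add]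
  rw [Finset.sum_eq_single (⟨v, hv⟩ : Fin m)]
  · intro i _ hi
    rw [perN_zero_row m _ v hv, mul_zero]
    intro j hj
    rw [Function.update_of_ne (fun h' => hi (Fin.ext h'.symm))]
    exact h j hj
  · simp

/-- Attach to `M` (of size `m`) a path with `p` internal vertices joining `u` and `v`. -/
def gad (y α β : R) (m u v p : ℕ) (M : ℕ → ℕ → R) : ℕ → ℕ → R := fun i j =>
  if p = 0 then
    M i j + (if i = u ∧ j = v then α else 0) + (if i = v ∧ j = u then β else 0)
  else if i < m then
    (if j < m then M i j else if i = u ∧ j = m then α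
      else if i = v ∧ j + 1 = m + p then β else 0)
  else if j < m then
    (if i = m ∧ j = u then -1 else if i + 1 = m + p ∧ j = v then -1 else 0)
  else if i = j then y else if i + 1 = j ∨ j + 1 = i then -1 else 0

/-- Attach to `M` (of size `m`) a pendant vertex at `u`. -/
def pend (y α : R) (m u : ℕ) (M : ℕ → ℕ → R) : ℕ → ℕ → R := fun i j =>
  if i < m then (if j < m then M i j else if i = u ∧ j = m then α else 0)
  else if j < m then (if i = m ∧ j = u then -1 else 0)
  else if i = m ∧ j = m then y else 0

theorem gad_succ (y α β : R) (m u v p : ℕ) (huv : u ≠ v) (hu : u < m) (hv : v < m)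
    (M : ℕ → ℕ → R) (i j : ℕ) (hi : i < m + (p + 1)) (hj : j < m + (p + 1)) :
    gad y α β m u v (p + 1) M i j = gad y (-1) β (m + 1) m v p (pend y α m u M) i j := by
  unfold gad pend
  rcases lt_trichotomy i m with h1 | h1 | h1 <;> rcases lt_trichotomy j m with h2 | h2 | h2 <;>
    rcases Nat.eq_zero_or_pos p with h3 | h3 <;> grind

/-- The continuant sequence, shifted by two. -/
def contF (y : R) : ℕ → R
  | 0 => 1
  | 1 => 0
  | (n + 2) => y * contF y (n + 1) + contF y n

theorem perN_gad (y β : R) (v p : ℕ) : ∀ (α : R) (m u : ℕ) (_ : u ≠ v) (_ : u < m) (_ : v < m)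
    (M : ℕ → ℕ → R),
    perN (m + p) (gad y α β m u v p M) =
      contF y (p + 2) * perN m M
      - α * contF y (p + 1) * perN m (Function.update M u (eRow u))
      - β * contF y (p + 1) * perN m (Function.update M v (eRow v))
      + α * β * contF y p *
        perN m (Function.update (Function.update M u (eRow u)) v (eRow v))
      + (-1) ^ p * (α * perN m (Function.update M u (eRow v))
        + β * perN m (Function.update M v (eRow u))) := by
  induction p with
  | zero =>
    intro α m u huv hu hv M
    have e1 : perN (m + 0) (gad y α β m u v 0 M) =
        perN m (Function.update (Function.update M u (fun j => M u j + α * eRow v j)) v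
          (fun j => M v j + β * eRow u j)) := by
      refine perN_congr fun i j _ _ => ?_
      simp only [gad, Function.update_apply, eRow]
      split_ifs <;> grind
    have e2 : perN m (Function.update (Function.update M v (eRow u)) u (eRow v)) =
        perN m (Function.update (Function.update M u (eRow u)) v (eRow v)) := by
      rw [← perN_swap m _ u v hu hv]
      refine perN_congr fun i j _ _ => ?_
      simp only [Function.update_apply, Equiv.swap_apply_def]
      split_ifs <;> grind
    rw [e1, perN_update_add m _ v hv]
    have e3 : Function.update (Function.update M u (fun j => M u j + α * eRow v j)) v (fun j => M v j)
        = Function.update M u (fun j => M u j + α * eRow v j) := by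
      funext i; simp only [Function.update_apply]; split_ifs <;> grind
    have e4 : Function.update M u (fun j => M u j) = M := Function.update_eq_self u M
    rw [e3, perN_update_add m _ u hu, Function.update_comm huv, e4]
    have e5 : (fun j => M u j + α * eRow v j)
      = (fun j => (Function.update M v (eRow u)) u j + α * (eRow v : ℕ → R) j) := by
      funext j; rw [Function.update_of_ne huv]
    rw [e5, perN_update_add m _ u hu, e2]
    have e6 : Function.update (Function.update M v (eRow u)) u
      (fun j => (Function.update M v (eRow u)) u j) = Function.update M v (eRow u) :=
      Function.update_eq_self u _
    rw [e6]
    simp only [contF]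
    ring
  | succ p ih =>
    intro α m u huv hu hv M
    have e0 : perN (m + (p + 1)) (gad y α β m u v (p + 1) M) =
        perN (m + 1 + p) (gad y (-1) β (m + 1) m v p (pend y α m u M)) := by
      rw [show m + 1 + p = m + (p + 1) by ring]
      exact perN_congr fun i j hi hj => gad_succ y α β m u v p huv hu hv M i j hi hj
    rw [e0, ih (-1) (m + 1) m (by omega) (by omega) (by omega)]
    have f1 : ∀ M : ℕ → ℕ → R, perN (m + 1) (pend y α m u M) =
        y * perN m M - α * perN m (Function.update M u (eRow u)) := by
      intro M
      rw [perN_succ_col m _ u hu (by intro i hi hne; simp [pend, hi, hne])]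
      have g1 : perN m (pend y α m u M) = perN m M :=
        perN_congr fun i j hi hj => by simp [pend, hi, hj]
      have g2 : perN m (Function.update (pend y α m u M) u (pend y α m u M m)) =
          perN m (Function.update M u (fun j => -1 * eRow u j)) :=
        perN_congr fun i j hi hj => by
          clear * - hu hv huv hi hj
          simp only [Function.update_apply]
          split_ifs <;> simp only [pend, eRow] <;> split_ifs <;> grind
      rw [g1, g2, perN_update_smul m _ u hu]
      simp [pend, hu]
      ring
    have f2 : ∀ M : ℕ → ℕ → R,
        perN (m + 1) (Function.update (pend y α m u M) m (eRow m)) = perN m M := by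
      intro M
      rw [perN_succ_col m _ u hu
        (by intro i hi hne; simp [pend, hi, hne, Function.update_apply, hi.ne])]
      have g1 : perN m (Function.update (pend y α m u M) m (eRow m)) = perN m M :=
        perN_congr fun i j hi hj => by simp [pend, hi, hj, Function.update_apply, hi.ne]
      rw [g1, perN_zero_row m (Function.update (Function.update _ _ _) _ _) u hu]
      · simp [eRow]
      · intro j hj
        simp [eRow, hj.ne]
    have f3 : Function.update (pend y α m u M) v (eRow v) =
        pend y α m u (Function.update M v (eRow v)) := by
      clear * - hu hv huv
      funext i j
      by_cases h : i = v
      · subst h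
        simp only [Function.update_self, pend, eRow]
        split_ifs <;> grind
      · simp only [pend, Function.update_of_ne h]
    have f4 : Function.update (Function.update (pend y α m u M) m (eRow m)) v (eRow v) =
        Function.update (pend y α m u (Function.update M v (eRow v))) m (eRow m) := by
      rw [Function.update_comm (by omega), f3]
    have f5 : perN (m + 1) (Function.update (pend y α m u M) m (eRow v)) =
        α * perN m (Function.update M u (eRow v)) := by
      rw [perN_succ_col m _ u hu
        (by intro i hi hne; simp [pend, hi, hne, Function.update_apply, hi.ne])]
      have g2 : perN m (Function.update (Function.update (pend y α m u M) m (eRow v)) u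
            (Function.update (pend y α m u M) m (eRow v) m)) =
          perN m (Function.update M u (eRow v)) :=
        perN_congr fun i j hi hj => by
          clear * - hu hv huv hi hj
          simp only [Function.update_apply]
          split_ifs <;> simp only [pend, eRow] <;> split_ifs <;> grind
      rw [g2]
      simp [eRow, pend, Function.update_apply, hv.ne', hu.ne, hu]
    have f6 : perN (m + 1) (Function.update (pend y α m u M) v (eRow m)) =
        - perN m (Function.update M v (eRow u)) := by
      rw [perN_succ_row m _ v hv (by intro j hj; simp [eRow, hj.ne])]
      have g2 : perN m (Function.update (Function.update (pend y α m u M) v (eRow m)) v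
            (Function.update (pend y α m u M) v (eRow m) m)) =
          perN m (Function.update M v (fun j => -1 * eRow u j)) :=
        perN_congr fun i j hi hj => by
          clear * - hu hv huv hi hj
          simp only [Function.update_apply]
          split_ifs <;> simp only [pend, eRow] <;> split_ifs <;> grind
      rw [g2, perN_update_smul m _ v hv]
      simp [eRow]
    rw [f1, f2, f4, f2, f3, f1, f5, f6, Function.update_comm huv.symm]
    simp only [contF]
    ring

end Gadget

/-! ### The permanent of the theta matrix -/

section ThetaMatrix

variable {R : Type*} [CommRing R]

theorem gad_upd_u (y α β : R) (m u v p k : ℕ) (huv : u ≠ v) (hu : u < m) (hk : k < m)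
    (M : ℕ → ℕ → R) :
    Function.update (gad y α β m u v p M) u (eRow k) =
      gad y 0 β m u v p (Function.update M u (eRow k)) := by
  funext i j
  by_cases h : i = u
  · subst h
    simp only [Function.update_self, gad, eRow]
    split_ifs <;> grind
  · simp only [gad, Function.update_of_ne h]
    split_ifs <;> grind

theorem gad_upd_v (y α β : R) (m u v p k : ℕ) (huv : u ≠ v) (hv : v < m) (hk : k < m)
    (M : ℕ → ℕ → R) :
    Function.update (gad y α β m u v p M) v (eRow k) =
      gad y α 0 m u v p (Function.update M v (eRow k)) := by
  funext i j
  by_cases h : i = v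
  · subst h
    simp only [Function.update_self, gad, eRow]
    split_ifs <;> grind
  · simp only [gad, Function.update_of_ne h]
    split_ifs <;> grind

theorem perN_two (N : ℕ → ℕ → R) : perN 2 N = N 0 0 * N 1 1 + N 0 1 * N 1 0 := by
  have h1 : ∀ N : ℕ → ℕ → R, perN 1 N = N 0 0 := by
    intro N
    simp [perN]
  rw [perN_succ]
  simp [h1]
  ring

/-- The base matrix: two isolated hubs. -/
def hubM (z : R) : ℕ → ℕ → R := fun i j => if i = j then z else 0

/-- The theta matrix. -/
def thM (y z : R) (p q r : ℕ) : ℕ → ℕ → R :=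
  gad y (-1) (-1) (2 + p + q) 0 1 r (gad y (-1) (-1) (2 + p) 0 1 q
    (gad y (-1) (-1) 2 0 1 p (hubM z)))

/-- Closed form of the permanent of the theta matrix. -/
def thForm (y z : R) (p q r : ℕ) : R :=
  z ^ 2 * (contF y (p + 2) * contF y (q + 2) * contF y (r + 2))
  + 2 * z * (contF y (p + 1) * contF y (q + 2) * contF y (r + 2)
    + contF y (p + 2) * contF y (q + 1) * contF y (r + 2)
    + contF y (p + 2) * contF y (q + 2) * contF y (r + 1))
  + (contF y p * contF y (q + 2) * contF y (r + 2)
    + contF y (p + 2) * contF y q * contF y (r + 2)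
    + contF y (p + 2) * contF y (q + 2) * contF y r)
  + 2 * (contF y (p + 1) * contF y (q + 1) * contF y (r + 2)
    + contF y (p + 1) * contF y (q + 2) * contF y (r + 1)
    + contF y (p + 2) * contF y (q + 1) * contF y (r + 1))
  + 2 * ((-1) ^ p * (-1) ^ q * contF y (r + 2)
    + (-1) ^ p * (-1) ^ r * contF y (q + 2)
    + (-1) ^ q * (-1) ^ r * contF y (p + 2))

theorem perN_thM (y z : R) (p q r : ℕ) :
    perN (2 + p + q + r) (thM y z p q r) = thForm y z p q r := by
  have H3 := fun α β M => perN_gad y β 1 r α (2 + p + q) 0 (by omega) (by omega) (by omega) M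
  have H2 := fun α β M => perN_gad y β 1 q α (2 + p) 0 (by omega) (by omega) (by omega) M
  have H1 := fun α β M => perN_gad y β 1 p α 2 0 (by omega) (by omega) (by omega) M
  have U2 := fun α β k hk M => gad_upd_u y α β (2 + p) 0 1 q k (by omega) (by omega) hk M
  have U1 := fun α β k hk M => gad_upd_u y α β 2 0 1 p k (by omega) (by omega) hk M
  have V2 := fun α β k hk M => gad_upd_v y α β (2 + p) 0 1 q k (by omega) (by omega) hk M
  have V1 := fun α β k hk M => gad_upd_v y α β 2 0 1 p k (by omega) (by omega) hk M
  have U20 := fun α β M => U2 α β 0 (by omega) M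
  have U21 := fun α β M => U2 α β 1 (by omega) M
  have V20 := fun α β M => V2 α β 0 (by omega) M
  have V21 := fun α β M => V2 α β 1 (by omega) M
  have U10 := fun α β M => U1 α β 0 (by omega) M
  have U11 := fun α β M => U1 α β 1 (by omega) M
  have V10 := fun α β M => V1 α β 0 (by omega) M
  have V11 := fun α β M => V1 α β 1 (by omega) M
  unfold thM thForm
  rw [H3]
  simp only [U20, U21, V20, V21, H2, zero_mul, mul_zero, add_zero, sub_zero, zero_add]
  simp only [U10, U11, V10, V11, H1, zero_mul, mul_zero, add_zero, sub_zero, zero_add]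
  simp only [perN_two, Function.update_apply]
  simp [eRow, hubM]
  ring

end ThetaMatrix

/-! ### The signless Laplacian of the theta graph -/

section ThetaGraph

theorem theta_adj (p q r : ℕ) (i j : Fin (p + q + r + 2)) :
    (thetaGraph p q r).Adj i j ↔ i.val ≠ j.val ∧ (
    ((p = 0 ∧ i.val = 0 ∧ j.val = 1) ∨
    (0 < p ∧ i.val = 0 ∧ j.val = 2) ∨
    (2 ≤ i.val ∧ i.val + 1 = j.val ∧ j.val < p + 2) ∨
    (0 < p ∧ i.val = p + 1 ∧ j.val = 1) ∨
    (q = 0 ∧ i.val = 0 ∧ j.val = 1) ∨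
    (0 < q ∧ i.val = 0 ∧ j.val = p + 2) ∨
    (p + 2 ≤ i.val ∧ i.val + 1 = j.val ∧ j.val < p + q + 2) ∨
    (0 < q ∧ i.val = p + q + 1 ∧ j.val = 1) ∨
    (r = 0 ∧ i.val = 0 ∧ j.val = 1) ∨
    (0 < r ∧ i.val = 0 ∧ j.val = p + q + 2) ∨
    (p + q + 2 ≤ i.val ∧ i.val + 1 = j.val) ∨
    (0 < r ∧ i.val = p + q + r + 1 ∧ j.val = 1)) ∨
    ((p = 0 ∧ j.val = 0 ∧ i.val = 1) ∨
    (0 < p ∧ j.val = 0 ∧ i.val = 2) ∨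
    (2 ≤ j.val ∧ j.val + 1 = i.val ∧ i.val < p + 2) ∨
    (0 < p ∧ j.val = p + 1 ∧ i.val = 1) ∨
    (q = 0 ∧ j.val = 0 ∧ i.val = 1) ∨
    (0 < q ∧ j.val = 0 ∧ i.val = p + 2) ∨
    (p + 2 ≤ j.val ∧ j.val + 1 = i.val ∧ i.val < p + q + 2) ∨
    (0 < q ∧ j.val = p + q + 1 ∧ i.val = 1) ∨
    (r = 0 ∧ j.val = 0 ∧ i.val = 1) ∨
    (0 < r ∧ j.val = 0 ∧ i.val = p + q + 2) ∨
    (p + q + 2 ≤ j.val ∧ j.val + 1 = i.val) ∨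
    (0 < r ∧ j.val = p + q + r + 1 ∧ i.val = 1))) := by
  rw [thetaGraph, SimpleGraph.fromRel_adj, ne_eq, Fin.ext_iff]

set_option maxHeartbeats 4000000 in
theorem theta_degree (p q r : ℕ)
    (h0 : (0 < p ∧ 0 < q) ∨ (0 < p ∧ 0 < r) ∨ (0 < q ∧ 0 < r)) (i : Fin (p + q + r + 2))
    [Fintype ((thetaGraph p q r).neighborSet i)] :
    (thetaGraph p q r).degree i = if i.val < 2 then 3 else 2 := by
  rw [← SimpleGraph.card_neighborFinset_eq_degree]
  obtain ⟨i, hi⟩ := i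
  split_ifs with h2
  · simp only at h2
    rw [Finset.card_eq_three]
    obtain rfl | rfl : i = 0 ∨ i = 1 := by omega
    · refine ⟨⟨if p = 0 then 1 else 2, by split_ifs <;> omega⟩,
        ⟨if q = 0 then 1 else p + 2, by split_ifs <;> omega⟩,
        ⟨if r = 0 then 1 else p + q + 2, by split_ifs <;> omega⟩, ?_, ?_, ?_, ?_⟩
      · rw [ne_eq, Fin.ext_iff]; dsimp only; split_ifs <;> first | omega | exact not_false
      · rw [ne_eq, Fin.ext_iff]; dsimp only; split_ifs <;> first | omega | exact not_false
      · rw [ne_eq, Fin.ext_iff]; dsimp only; split_ifs <;> first | omega | exact not_false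
      · ext ⟨j, hj⟩
        simp only [SimpleGraph.mem_neighborFinset, theta_adj, Fin.ext_iff,
          Finset.mem_insert, Finset.mem_singleton, ne_eq]
        split_ifs <;> grind
    · refine ⟨⟨if p = 0 then 0 else p + 1, by split_ifs <;> omega⟩,
        ⟨if q = 0 then 0 else p + q + 1, by split_ifs <;> omega⟩,
        ⟨if r = 0 then 0 else p + q + r + 1, by split_ifs <;> omega⟩, ?_, ?_, ?_, ?_⟩
      · rw [ne_eq, Fin.ext_iff]; dsimp only; split_ifs <;> first | omega | exact not_false
      · rw [ne_eq, Fin.ext_iff]; dsimp only; split_ifs <;> first | omega | exact not_false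
      · rw [ne_eq, Fin.ext_iff]; dsimp only; split_ifs <;> first | omega | exact not_false
      · ext ⟨j, hj⟩
        simp only [SimpleGraph.mem_neighborFinset, theta_adj, Fin.ext_iff,
          Finset.mem_insert, Finset.mem_singleton, ne_eq]
        split_ifs <;> grind
  · simp only at h2
    rw [Finset.card_eq_two]
    refine ⟨⟨if i = 2 ∨ i = p + 2 ∨ i = p + q + 2 then 0 else i - 1, by split_ifs <;> omega⟩,
        ⟨if i = p + 1 ∨ i = p + q + 1 ∨ i = p + q + r + 1 then 1 else i + 1,
          by split_ifs <;> omega⟩, ?_, ?_⟩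
    · rw [ne_eq, Fin.ext_iff]; dsimp only; split_ifs <;> first | omega | exact not_false
    · ext ⟨j, hj⟩
      simp only [SimpleGraph.mem_neighborFinset, theta_adj, Fin.ext_iff,
        Finset.mem_insert, Finset.mem_singleton, ne_eq]
      constructor
      · intro h
        split_ifs <;> omega
      · intro h
        refine ⟨by split_ifs at h <;> omega, ?_⟩
        rcases lt_or_ge i (p + 2) with h3 | h3
        ·
          have H : (0 < p ∧ i = p + 1 ∧ j = 1) ∨ (2 ≤ i ∧ i + 1 = j ∧ j < p + 2) ∨
              (0 < p ∧ j = 0 ∧ i = 2) ∨ (2 ≤ j ∧ j + 1 = i ∧ i < p + 2) := by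
            split_ifs at h <;> omega
          rcases H with H | H | H | H
          · left; repeat (first | exact H | exact Or.inl H | apply Or.inr)
          · left; repeat (first | exact H | exact Or.inl H | apply Or.inr)
          · right; repeat (first | exact H | exact Or.inl H | apply Or.inr)
          · right; repeat (first | exact H | exact Or.inl H | apply Or.inr)
        rcases lt_or_ge i (p + q + 2) with h4 | h4
        ·
          have H : (0 < q ∧ i = p + q + 1 ∧ j = 1) ∨ (p + 2 ≤ i ∧ i + 1 = j ∧ j < p + q + 2) ∨
              (0 < q ∧ j = 0 ∧ i = p + 2) ∨ (p + 2 ≤ j ∧ j + 1 = i ∧ i < p + q + 2) := by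
            split_ifs at h <;> omega
          rcases H with H | H | H | H
          · left; repeat (first | exact H | exact Or.inl H | apply Or.inr)
          · left; repeat (first | exact H | exact Or.inl H | apply Or.inr)
          · right; repeat (first | exact H | exact Or.inl H | apply Or.inr)
          · right; repeat (first | exact H | exact Or.inl H | apply Or.inr)
        ·
          have H : (0 < r ∧ i = p + q + r + 1 ∧ j = 1) ∨ (p + q + 2 ≤ i ∧ i + 1 = j) ∨
              (0 < r ∧ j = 0 ∧ i = p + q + 2) ∨ (p + q + 2 ≤ j ∧ j + 1 = i) := by
            split_ifs at h <;> omega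
          rcases H with H | H | H | H
          · left; repeat (first | exact H | exact Or.inl H | apply Or.inr)
          · left; repeat (first | exact H | exact Or.inl H | apply Or.inr)
          · right; repeat (first | exact H | exact Or.inl H | apply Or.inr)
          · right; repeat (first | exact H | exact Or.inl H | apply Or.inr)

end ThetaGraph

/-! ### Entries -/

section Entries

variable {R : Type*} [CommRing R]

theorem thM_diag (y z : R) (p q r i : ℕ) (hi : i < p + q + r + 2) :
    thM y z p q r i i = if i < 2 then z else y := by
  simp only [thM, gad, hubM]
  grind

theorem thM_neg_one (y z : R) (p q r i j : ℕ)
    (h0 : (0 < p ∧ 0 < q) ∨ (0 < p ∧ 0 < r) ∨ (0 < q ∧ 0 < r))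
    (h : (p = 0 ∧ i = 0 ∧ j = 1) ∨
    (0 < p ∧ i = 0 ∧ j = 2) ∨
    (2 ≤ i ∧ i + 1 = j ∧ j < p + 2) ∨
    (0 < p ∧ i = p + 1 ∧ j = 1) ∨
    (q = 0 ∧ i = 0 ∧ j = 1) ∨
    (0 < q ∧ i = 0 ∧ j = p + 2) ∨
    (p + 2 ≤ i ∧ i + 1 = j ∧ j < p + q + 2) ∨
    (0 < q ∧ i = p + q + 1 ∧ j = 1) ∨
    (r = 0 ∧ i = 0 ∧ j = 1) ∨
    (0 < r ∧ i = 0 ∧ j = p + q + 2) ∨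
    (p + q + 2 ≤ i ∧ i + 1 = j) ∨
    (0 < r ∧ i = p + q + r + 1 ∧ j = 1)) (hi : i < p + q + r + 2) (hj : j < p + q + r + 2) :
    thM y z p q r i j = -1 ∧ thM y z p q r j i = -1 := by
  simp only [thM, gad, hubM]
  rcases h with h | h | h | h | h | h | h | h | h | h | h | h <;> constructor <;> grind

set_option maxHeartbeats 2000000 in
theorem thM_zero_lt (y z : R) (p q r i j : ℕ) (hlt : i < j)
    (hj : j < p + q + r + 2)
    (h : ¬ ((p = 0 ∧ i = 0 ∧ j = 1) ∨
    (0 < p ∧ i = 0 ∧ j = 2) ∨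
    (2 ≤ i ∧ i + 1 = j ∧ j < p + 2) ∨
    (0 < p ∧ i = p + 1 ∧ j = 1) ∨
    (q = 0 ∧ i = 0 ∧ j = 1) ∨
    (0 < q ∧ i = 0 ∧ j = p + 2) ∨
    (p + 2 ≤ i ∧ i + 1 = j ∧ j < p + q + 2) ∨
    (0 < q ∧ i = p + q + 1 ∧ j = 1) ∨
    (r = 0 ∧ i = 0 ∧ j = 1) ∨
    (0 < r ∧ i = 0 ∧ j = p + q + 2) ∨
    (p + q + 2 ≤ i ∧ i + 1 = j) ∨
    (0 < r ∧ i = p + q + r + 1 ∧ j = 1)))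
    (h' : ¬ ((0 < p ∧ j = p + 1 ∧ i = 1) ∨
      (0 < q ∧ j = p + q + 1 ∧ i = 1) ∨
      (0 < r ∧ j = p + q + r + 1 ∧ i = 1))) :
    thM y z p q r i j = 0 ∧ thM y z p q r j i = 0 := by
  simp only [not_or] at h h'
  obtain ⟨a1, a2, a3, a4, a5, a6, a7, a8, a9, a10, a11, a12⟩ := h
  obtain ⟨b1, b2, b3⟩ := h'
  simp only [thM, gad, hubM]
  obtain hi0 | hi1 | hi2 : i = 0 ∨ i = 1 ∨ 2 ≤ i := by omega
  · clear a3 a4 a7 a8 a11 a12 b1 b2 b3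
    subst hi0
    constructor <;> grind
  · clear a1 a2 a3 a4 a5 a6 a7 a8 a9 a10 a11 a12
    subst hi1
    constructor <;> grind
  · clear a1 a2 a4 a5 a6 a8 a9 a10 a12 b1 b2 b3
    constructor <;> grind

end Entries

/-! ### The polynomial -/

section Poly

theorem thM_zero (p q r : ℕ) {R : Type*} [CommRing R] (y z : R)
    (i j : Fin (p + q + r + 2)) (hlt : i.val < j.val)
    (h : ¬ (thetaGraph p q r).Adj i j) : thM y z p q r i j = 0 ∧ thM y z p q r j i = 0 := by
  rw [theta_adj] at h
  have h1 := not_or.1 (fun h' => h ⟨hlt.ne, h'⟩)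
  refine thM_zero_lt y z p q r i j hlt j.2 h1.1 ?_
  have h2 := h1.2
  simp only [not_or] at h2 ⊢
  exact ⟨h2.2.2.2.1, h2.2.2.2.2.2.2.2.1, h2.2.2.2.2.2.2.2.2.2.2.2⟩

theorem theta_entry (p q r : ℕ)
    (h0 : (0 < p ∧ 0 < q) ∨ (0 < p ∧ 0 < r) ∨ (0 < q ∧ 0 < r)) (i j : Fin (p + q + r + 2))
    [DecidableEq (Fin (p + q + r + 2))] :
    (Matrix.diagonal (fun _ : Fin (p + q + r + 2) => (X : Polynomial ℚ)) -
      (signlessLapMatrix (thetaGraph p q r)).map Polynomial.C) i j =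
      thM (X - 2 : ℚ[X]) (X - 3) p q r i j := by
  by_cases hij : i = j
  · subst hij
    rw [thM_diag _ _ _ _ _ _ i.2]
    simp only [Matrix.sub_apply, Matrix.diagonal_apply_eq, Matrix.map_apply, signlessLapMatrix,
      Matrix.add_apply, SimpleGraph.degMatrix, SimpleGraph.adjMatrix_apply, SimpleGraph.irrefl,
      if_false, add_zero, theta_degree p q r h0]
    split_ifs
    · simp [show (C 3 : ℚ[X]) = 3 from rfl]
    · simp [show (C 2 : ℚ[X]) = 2 from rfl]
  · have hne : i.val ≠ j.val := fun h => hij (Fin.ext h)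
    simp only [Matrix.sub_apply, Matrix.map_apply,
      signlessLapMatrix, Matrix.add_apply, SimpleGraph.degMatrix, SimpleGraph.adjMatrix_apply,
      zero_sub, Matrix.diagonal_apply, if_neg hij, zero_add]
    split_ifs with h
    · rw [theta_adj] at h
      rcases h.2 with h | h
      · rw [(thM_neg_one _ _ p q r i j h0 h i.2 j.2).1]; simp
      · rw [(thM_neg_one _ _ p q r j i h0 h j.2 i.2).2]; simp
    · rcases lt_or_gt_of_ne hne with h1 | h1
      · rw [(thM_zero p q r _ _ i j h1 h).1]; simp
      · rw [(thM_zero p q r _ _ j i h1 (fun h' => h h'.symm)).2]; simp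

theorem qPermPoly_theta (p q r : ℕ)
    (h0 : (0 < p ∧ 0 < q) ∨ (0 < p ∧ 0 < r) ∨ (0 < q ∧ 0 < r)) :
    qPermPoly (thetaGraph p q r) = thForm (X - 2 : ℚ[X]) (X - 3) p q r := by
  rw [← perN_thM, show 2 + p + q + r = p + q + r + 2 by ring]
  unfold qPermPoly perN Matrix.permanent
  refine Finset.sum_congr (by ext; simp) fun σ _ => Finset.prod_congr rfl fun j _ => ?_
  convert theta_entry p q r h0 (σ j) j

end Poly

/-! ### Symmetries of the theta graph -/

section Iso

theorem theta_swap12_hom (p q r : ℕ) (i j : ℕ)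
    (f : ℕ → ℕ) (hf : f = fun k => if k < 2 then k else if k < p + 2 then k + q else
      if k < p + q + 2 then k - p else k)
    (h : (p = 0 ∧ i = 0 ∧ j = 1) ∨
    (0 < p ∧ i = 0 ∧ j = 2) ∨
    (2 ≤ i ∧ i + 1 = j ∧ j < p + 2) ∨
    (0 < p ∧ i = p + 1 ∧ j = 1) ∨
    (q = 0 ∧ i = 0 ∧ j = 1) ∨
    (0 < q ∧ i = 0 ∧ j = p + 2) ∨
    (p + 2 ≤ i ∧ i + 1 = j ∧ j < p + q + 2) ∨
    (0 < q ∧ i = p + q + 1 ∧ j = 1) ∨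
    (r = 0 ∧ i = 0 ∧ j = 1) ∨
    (0 < r ∧ i = 0 ∧ j = p + q + 2) ∨
    (p + q + 2 ≤ i ∧ i + 1 = j) ∨
    (0 < r ∧ i = p + q + r + 1 ∧ j = 1)) :
    (q = 0 ∧ f i = 0 ∧ f j = 1) ∨
    (0 < q ∧ f i = 0 ∧ f j = 2) ∨
    (2 ≤ f i ∧ f i + 1 = f j ∧ f j < q + 2) ∨
    (0 < q ∧ f i = q + 1 ∧ f j = 1) ∨
    (p = 0 ∧ f i = 0 ∧ f j = 1) ∨
    (0 < p ∧ f i = 0 ∧ f j = q + 2) ∨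
    (q + 2 ≤ f i ∧ f i + 1 = f j ∧ f j < q + p + 2) ∨
    (0 < p ∧ f i = q + p + 1 ∧ f j = 1) ∨
    (r = 0 ∧ f i = 0 ∧ f j = 1) ∨
    (0 < r ∧ f i = 0 ∧ f j = q + p + 2) ∨
    (q + p + 2 ≤ f i ∧ f i + 1 = f j) ∨
    (0 < r ∧ f i = q + p + r + 1 ∧ f j = 1) := by
  have H : ∀ k, f k = if k < 2 then k else if k < p + 2 then k + q else
      if k < p + q + 2 then k - p else k := fun k => by rw [hf]
  have Hi := H i
  have Hj := H j
  clear H hf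
  generalize f i = fi at *
  generalize f j = fj at *
  rcases h with h | h | h | h | h | h | h | h | h | h | h | h
  · iterate 4 right
    left; grind
  · iterate 5 right
    left; grind
  · iterate 6 right
    left; grind
  · iterate 7 right
    left; grind
  · left; grind
  · iterate 1 right
    left; grind
  · iterate 2 right
    left; grind
  · iterate 3 right
    left; grind
  · iterate 8 right
    left; grind
  · iterate 9 right
    left; grind
  · iterate 10 right
    left; grind
  · iterate 11 right
    grind

theorem theta_swap23_hom (p q r : ℕ) (i j : ℕ) (hj' : j < p + q + r + 2)
    (f : ℕ → ℕ) (hf : f = fun k => if k < p + 2 then k else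
      if k < p + q + 2 then k + r else k - q)
    (h : (p = 0 ∧ i = 0 ∧ j = 1) ∨
    (0 < p ∧ i = 0 ∧ j = 2) ∨
    (2 ≤ i ∧ i + 1 = j ∧ j < p + 2) ∨
    (0 < p ∧ i = p + 1 ∧ j = 1) ∨
    (q = 0 ∧ i = 0 ∧ j = 1) ∨
    (0 < q ∧ i = 0 ∧ j = p + 2) ∨
    (p + 2 ≤ i ∧ i + 1 = j ∧ j < p + q + 2) ∨
    (0 < q ∧ i = p + q + 1 ∧ j = 1) ∨
    (r = 0 ∧ i = 0 ∧ j = 1) ∨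
    (0 < r ∧ i = 0 ∧ j = p + q + 2) ∨
    (p + q + 2 ≤ i ∧ i + 1 = j) ∨
    (0 < r ∧ i = p + q + r + 1 ∧ j = 1)) :
    (p = 0 ∧ f i = 0 ∧ f j = 1) ∨
    (0 < p ∧ f i = 0 ∧ f j = 2) ∨
    (2 ≤ f i ∧ f i + 1 = f j ∧ f j < p + 2) ∨
    (0 < p ∧ f i = p + 1 ∧ f j = 1) ∨
    (r = 0 ∧ f i = 0 ∧ f j = 1) ∨
    (0 < r ∧ f i = 0 ∧ f j = p + 2) ∨
    (p + 2 ≤ f i ∧ f i + 1 = f j ∧ f j < p + r + 2) ∨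
    (0 < r ∧ f i = p + r + 1 ∧ f j = 1) ∨
    (q = 0 ∧ f i = 0 ∧ f j = 1) ∨
    (0 < q ∧ f i = 0 ∧ f j = p + r + 2) ∨
    (p + r + 2 ≤ f i ∧ f i + 1 = f j) ∨
    (0 < q ∧ f i = p + r + q + 1 ∧ f j = 1) := by
  have H : ∀ k, f k = if k < p + 2 then k else
      if k < p + q + 2 then k + r else k - q := fun k => by rw [hf]
  have Hi := H i
  have Hj := H j
  clear H hf
  generalize f i = fi at *
  generalize f j = fj at *
  rcases h with h | h | h | h | h | h | h | h | h | h | h | h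
  · left; grind
  · iterate 1 right
    left; grind
  · iterate 2 right
    left; grind
  · iterate 3 right
    left; grind
  · iterate 8 right
    left; grind
  · iterate 9 right
    left; grind
  · iterate 10 right
    left; grind
  · iterate 11 right
    grind
  · iterate 4 right
    left; grind
  · iterate 5 right
    left; grind
  · iterate 6 right
    left; grind
  · iterate 7 right
    left; grind

/-- The map exchanging the first two paths. -/
def sw12 (p q r : ℕ) (i : Fin (p + q + r + 2)) : Fin (q + p + r + 2) :=
  ⟨if i.val < 2 then i.val else if i.val < p + 2 then i.val + q else
      if i.val < p + q + 2 then i.val - p else i.val, by have := i.2; split_ifs <;> omega⟩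

/-- The map exchanging the last two paths. -/
def sw23 (p q r : ℕ) (i : Fin (p + q + r + 2)) : Fin (p + r + q + 2) :=
  ⟨if i.val < p + 2 then i.val else
      if i.val < p + q + 2 then i.val + r else i.val - q, by have := i.2; split_ifs <;> omega⟩

theorem sw12_sw12 (p q r : ℕ) (i : Fin (p + q + r + 2)) : sw12 q p r (sw12 p q r i) = i := by
  obtain ⟨i, hi⟩ := i
  simp only [sw12, Fin.ext_iff]
  split_ifs <;> omega

theorem sw23_sw23 (p q r : ℕ) (i : Fin (p + q + r + 2)) : sw23 p r q (sw23 p q r i) = i := by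
  obtain ⟨i, hi⟩ := i
  simp only [sw23, Fin.ext_iff]
  split_ifs <;> omega

theorem sw12_adj (p q r : ℕ) (i j : Fin (p + q + r + 2)) (h : (thetaGraph p q r).Adj i j) :
    (thetaGraph q p r).Adj (sw12 p q r i) (sw12 p q r j) := by
  have hne : sw12 p q r i ≠ sw12 p q r j := fun h' => h.ne (by
    rw [← sw12_sw12 p q r i, h', sw12_sw12])
  rw [thetaGraph, SimpleGraph.fromRel_adj] at h ⊢
  exact ⟨hne, h.2.imp (theta_swap12_hom p q r i j _ rfl) (theta_swap12_hom p q r j i _ rfl)⟩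

theorem sw23_adj (p q r : ℕ) (i j : Fin (p + q + r + 2)) (h : (thetaGraph p q r).Adj i j) :
    (thetaGraph p r q).Adj (sw23 p q r i) (sw23 p q r j) := by
  have hne : sw23 p q r i ≠ sw23 p q r j := fun h' => h.ne (by
    rw [← sw23_sw23 p q r i, h', sw23_sw23])
  rw [thetaGraph, SimpleGraph.fromRel_adj] at h ⊢
  exact ⟨hne, h.2.imp (theta_swap23_hom p q r i j j.2 _ rfl)
    (theta_swap23_hom p q r j i i.2 _ rfl)⟩

theorem theta_iso12 (p q r : ℕ) : Nonempty (thetaGraph p q r ≃g thetaGraph q p r) :=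
  ⟨{ toFun := sw12 p q r
     invFun := sw12 q p r
     left_inv := sw12_sw12 p q r
     right_inv := sw12_sw12 q p r
     map_rel_iff' := by
      intro i j
      refine ⟨fun h => ?_, sw12_adj p q r i j⟩
      have := sw12_adj q p r _ _ h
      simpa only [Equiv.coe_fn_mk, sw12_sw12] using this }⟩

theorem theta_iso23 (p q r : ℕ) : Nonempty (thetaGraph p q r ≃g thetaGraph p r q) :=
  ⟨{ toFun := sw23 p q r
     invFun := sw23 p r q
     left_inv := sw23_sw23 p q r
     right_inv := sw23_sw23 p r q
     map_rel_iff' := by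
      intro i j
      refine ⟨fun h => ?_, sw23_adj p q r i j⟩
      have := sw23_adj p r q _ _ h
      simpa only [Equiv.coe_fn_mk, sw23_sw23] using this }⟩

theorem thForm_12 {R : Type*} [CommRing R] (y z : R) (p q r : ℕ) :
    thForm y z p q r = thForm y z q p r := by
  unfold thForm; ring

theorem thForm_23 {R : Type*} [CommRing R] (y z : R) (p q r : ℕ) :
    thForm y z p q r = thForm y z p r q := by
  unfold thForm; ring

theorem theta_sort (p q r : ℕ)
    (h0 : (0 < p ∧ 0 < q) ∨ (0 < p ∧ 0 < r) ∨ (0 < q ∧ 0 < r)) :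
    ∃ a b c : ℕ, c ≤ b ∧ b ≤ a ∧ 0 < b ∧ Nonempty (thetaGraph p q r ≃g thetaGraph a b c) ∧
      thForm (X - 2 : ℚ[X]) (X - 3) p q r = thForm (X - 2 : ℚ[X]) (X - 3) a b c := by
  have S12 : ∀ p q r : ℕ, (∃ a b c : ℕ, c ≤ b ∧ b ≤ a ∧ 0 < b ∧
      Nonempty (thetaGraph q p r ≃g thetaGraph a b c) ∧
      thForm (X - 2 : ℚ[X]) (X - 3) q p r = thForm (X - 2 : ℚ[X]) (X - 3) a b c) →
      ∃ a b c : ℕ, c ≤ b ∧ b ≤ a ∧ 0 < b ∧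
      Nonempty (thetaGraph p q r ≃g thetaGraph a b c) ∧
      thForm (X - 2 : ℚ[X]) (X - 3) p q r = thForm (X - 2 : ℚ[X]) (X - 3) a b c := by
    rintro p q r ⟨a, b, c, h1, h2, h3, ⟨e⟩, h5⟩
    obtain ⟨e'⟩ := theta_iso12 p q r
    exact ⟨a, b, c, h1, h2, h3, ⟨e'.trans e⟩, by rw [thForm_12, h5]⟩
  have S23 : ∀ p q r : ℕ, (∃ a b c : ℕ, c ≤ b ∧ b ≤ a ∧ 0 < b ∧
      Nonempty (thetaGraph p r q ≃g thetaGraph a b c) ∧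
      thForm (X - 2 : ℚ[X]) (X - 3) p r q = thForm (X - 2 : ℚ[X]) (X - 3) a b c) →
      ∃ a b c : ℕ, c ≤ b ∧ b ≤ a ∧ 0 < b ∧
      Nonempty (thetaGraph p q r ≃g thetaGraph a b c) ∧
      thForm (X - 2 : ℚ[X]) (X - 3) p q r = thForm (X - 2 : ℚ[X]) (X - 3) a b c := by
    rintro p q r ⟨a, b, c, h1, h2, h3, ⟨e⟩, h5⟩
    obtain ⟨e'⟩ := theta_iso23 p q r
    exact ⟨a, b, c, h1, h2, h3, ⟨e'.trans e⟩, by rw [thForm_23, h5]⟩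
  have B : ∀ p q r : ℕ, r ≤ q → q ≤ p → 0 < q → ∃ a b c : ℕ, c ≤ b ∧ b ≤ a ∧ 0 < b ∧
      Nonempty (thetaGraph p q r ≃g thetaGraph a b c) ∧
      thForm (X - 2 : ℚ[X]) (X - 3) p q r = thForm (X - 2 : ℚ[X]) (X - 3) a b c :=
    fun p q r h1 h2 h3 => ⟨p, q, r, h1, h2, h3, ⟨SimpleGraph.Iso.refl⟩, rfl⟩
  rcases le_total p q with h1 | h1 <;> rcases le_total q r with h2 | h2 <;>
    rcases le_total p r with h3 | h3
  · exact S12 _ _ _ (S23 _ _ _ (S12 _ _ _ (B _ _ _ h1 h2 (by omega))))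
  · exact S12 _ _ _ (S23 _ _ _ (S12 _ _ _ (B _ _ _ h1 h2 (by omega))))
  · exact S12 _ _ _ (S23 _ _ _ (B _ _ _ h3 h2 (by omega)))
  · exact S12 _ _ _ (B _ _ _ h3 h1 (by omega))
  · exact S23 _ _ _ (S12 _ _ _ (B _ _ _ h1 h3 (by omega)))
  · exact S23 _ _ _ (B _ _ _ h2 h3 (by omega))
  · exact B _ _ _ h2 h1 (by omega)
  · exact B _ _ _ h2 h1 (by omega)

end Iso

/-! ### Passage to Laurent polynomials -/

section Laurent

open LaurentPolynomial in
theorem lt_tu : (T 1 : LaurentPolynomial ℚ) * T (-1) = 1 := by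
  rw [← T_add]; simp

theorem map_contF {R S : Type*} [CommRing R] [CommRing S] (f : R →+* S) (y : R) (n : ℕ) :
    f (contF y n) = contF (f y) n := by
  induction n using contF.induct with
  | case1 => simp [contF]
  | case2 => simp [contF]
  | case3 n ih1 ih2 => simp [contF, ih1, ih2]

theorem map_thForm {R S : Type*} [CommRing R] [CommRing S] (f : R →+* S) (y z : R) (p q r : ℕ) :
    f (thForm y z p q r) = thForm (f y) (f z) p q r := by
  simp only [thForm, map_add, map_mul, map_pow, map_contF, map_neg, map_one, map_ofNat]

open LaurentPolynomial in
theorem contF_laurent (n : ℕ) :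
    (T 1 + T (-1) : LaurentPolynomial ℚ) * contF (T 1 - T (-1)) n =
      T n * T (-1) + (-1) ^ n * (T (-n) * T 1) := by
  have h := lt_tu
  induction n using contF.induct with
  | case1 => simp [contF]; ring
  | case2 => simp only [contF]; push_cast; linear_combination 0 * h
  | case3 n ih1 ih2 =>
    simp only [contF]
    have e1 : (T ((n + 1 : ℕ) : ℤ) : LaurentPolynomial ℚ) = T n * T 1 := by
      rw [← T_add]; push_cast; rfl
    have e2 : (T ((n + 1 + 1 : ℕ) : ℤ) : LaurentPolynomial ℚ) = T n * T 1 * T 1 := by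
      rw [← T_add, ← T_add]; push_cast; rfl
    have e3 : (T (-((n + 1 : ℕ) : ℤ)) : LaurentPolynomial ℚ) = T (-n) * T (-1) := by
      rw [← T_add]; congr 1; push_cast; ring
    have e4 : (T (-((n + 1 + 1 : ℕ) : ℤ)) : LaurentPolynomial ℚ) = T (-n) * T (-1) * T (-1) := by
      rw [← T_add, ← T_add]; congr 1; push_cast; ring
    rw [show n.succ.succ = n + 1 + 1 from rfl, e2, e4]
    rw [e1, e3] at ih1
    generalize (T (n : ℤ) : LaurentPolynomial ℚ) = A at *
    generalize (T (-n : ℤ) : LaurentPolynomial ℚ) = A' at *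
    generalize (T 1 : LaurentPolynomial ℚ) = t at *
    generalize (T (-1) : LaurentPolynomial ℚ) = u at *
    generalize contF (t - u) (n + 1) = F1 at *
    generalize contF (t - u) n = F0 at *
    linear_combination (t - u) * ih1 + ih2 + (-u * A - (-1) ^ n * t * A') * h

open LaurentPolynomial in
theorem contF_laurent' (p : ℕ) :
    ((T 1 + T (-1) : LaurentPolynomial ℚ) * contF (T 1 - T (-1)) (p + 2) =
      T ((p : ℤ) + 1) - (-1) ^ (p + 1) * T (-((p : ℤ) + 1))) ∧
    ((T 1 + T (-1) : LaurentPolynomial ℚ) * contF (T 1 - T (-1)) (p + 1) =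
      T (-1) * T ((p : ℤ) + 1) + (-1) ^ (p + 1) * T 1 * T (-((p : ℤ) + 1))) ∧
    ((T 1 + T (-1) : LaurentPolynomial ℚ) * contF (T 1 - T (-1)) p =
      T (-1) ^ 2 * T ((p : ℤ) + 1) - (-1) ^ (p + 1) * T 1 ^ 2 * T (-((p : ℤ) + 1))) := by
  simp only [contF_laurent]
  have h := lt_tu
  have e1 : (T ((p : ℤ) + 1) : LaurentPolynomial ℚ) = T p * T 1 := by rw [← T_add]
  have e2 : (T (-((p : ℤ) + 1)) : LaurentPolynomial ℚ) = T (-p) * T (-1) := by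
    rw [← T_add]; congr 1; ring
  have e3 : (T ((p + 1 : ℕ) : ℤ) : LaurentPolynomial ℚ) = T p * T 1 := by
    rw [← T_add]; push_cast; rfl
  have e4 : (T ((p + 2 : ℕ) : ℤ) : LaurentPolynomial ℚ) = T p * T 1 * T 1 := by
    rw [← T_add, ← T_add]; congr 1
  have e5 : (T (-((p + 1 : ℕ) : ℤ)) : LaurentPolynomial ℚ) = T (-p) * T (-1) := by
    rw [← T_add]; congr 1; push_cast; ring
  have e6 : (T (-((p + 2 : ℕ) : ℤ)) : LaurentPolynomial ℚ) = T (-p) * T (-1) * T (-1) := by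
    rw [← T_add, ← T_add]; congr 1; push_cast; ring
  rw [e1, e2, e3, e4, e5, e6]
  generalize (T (p : ℤ) : LaurentPolynomial ℚ) = A at *
  generalize (T (-p : ℤ) : LaurentPolynomial ℚ) = A' at *
  generalize (T 1 : LaurentPolynomial ℚ) = t at *
  generalize (T (-1) : LaurentPolynomial ℚ) = u at *
  refine ⟨?_, ?_, ?_⟩
  · linear_combination (A * t + (-1) ^ p * A' * u) * h
  · linear_combination 0 * h
  · linear_combination (-A * u - (-1) ^ p * A' * t) * h

open LaurentPolynomial in
theorem thForm_laurent (p q r : ℕ) (a b c : ℤ) (ha : a = p + 1) (hb : b = q + 1) (hc : c = r + 1)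
    (α β γ : LaurentPolynomial ℚ)
    (hα : α = (-1) ^ (p + 1)) (hβ : β = (-1) ^ (q + 1)) (hγ : γ = (-1) ^ (r + 1))
    (t u : LaurentPolynomial ℚ) (ht : t = T 1) (hu : u = T (-1)) :
    (t + u) ^ 3 * thForm (t - u) (t - u - 1) p q r =
      T (a + b + c) * (t + 2 * u - 1) ^ 2
      - α * (T (b + c - a) * (u - 1) ^ 2)
      - β * (T (a + c - b) * (u - 1) ^ 2)
      - γ * (T (a + b - c) * (u - 1) ^ 2)
      + α * β * (T (c - a - b) * (t + 1) ^ 2)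
      + α * γ * (T (b - a - c) * (t + 1) ^ 2)
      + β * γ * (T (a - b - c) * (t + 1) ^ 2)
      - α * β * γ * (T (- a - b - c) * (2 * t + u + 1) ^ 2)
      + 2 * α * β * (T c * (t + u) ^ 2) - 2 * α * β * γ * (T (-c) * (t + u) ^ 2)
      + 2 * α * γ * (T b * (t + u) ^ 2) - 2 * α * β * γ * (T (-b) * (t + u) ^ 2)
      + 2 * β * γ * (T a * (t + u) ^ 2) - 2 * α * β * γ * (T (-a) * (t + u) ^ 2) := by
  obtain ⟨a2, a1, a0⟩ := contF_laurent' p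
  obtain ⟨b2, b1, b0⟩ := contF_laurent' q
  obtain ⟨c2, c1, c0⟩ := contF_laurent' r
  rw [← ha, ← hα, ← ht, ← hu] at a2 a1 a0
  rw [← hb, ← hβ, ← ht, ← hu] at b2 b1 b0
  rw [← hc, ← hγ, ← ht, ← hu] at c2 c1 c0
  have hp : ((-1) ^ p : LaurentPolynomial ℚ) = - α := by rw [hα]; ring
  have hq : ((-1) ^ q : LaurentPolynomial ℚ) = - β := by rw [hβ]; ring
  have hr : ((-1) ^ r : LaurentPolynomial ℚ) = - γ := by rw [hγ]; ring
  have E1 : (t + u) ^ 3 * thForm (t - u) (t - u - 1) p q r =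
    (t - u - 1) ^ 2 * (((t + u) * contF (t - u) (p + 2)) * ((t + u) * contF (t - u) (q + 2)) *
      ((t + u) * contF (t - u) (r + 2)))
  + 2 * (t - u - 1) * (((t + u) * contF (t - u) (p + 1)) * ((t + u) * contF (t - u) (q + 2)) *
      ((t + u) * contF (t - u) (r + 2))
    + ((t + u) * contF (t - u) (p + 2)) * ((t + u) * contF (t - u) (q + 1)) *
      ((t + u) * contF (t - u) (r + 2))
    + ((t + u) * contF (t - u) (p + 2)) * ((t + u) * contF (t - u) (q + 2)) *
      ((t + u) * contF (t - u) (r + 1)))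
  + (((t + u) * contF (t - u) p) * ((t + u) * contF (t - u) (q + 2)) *
      ((t + u) * contF (t - u) (r + 2))
    + ((t + u) * contF (t - u) (p + 2)) * ((t + u) * contF (t - u) q) *
      ((t + u) * contF (t - u) (r + 2))
    + ((t + u) * contF (t - u) (p + 2)) * ((t + u) * contF (t - u) (q + 2)) *
      ((t + u) * contF (t - u) r))
  + 2 * (((t + u) * contF (t - u) (p + 1)) * ((t + u) * contF (t - u) (q + 1)) *
      ((t + u) * contF (t - u) (r + 2))
    + ((t + u) * contF (t - u) (p + 1)) * ((t + u) * contF (t - u) (q + 2)) *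
      ((t + u) * contF (t - u) (r + 1))
    + ((t + u) * contF (t - u) (p + 2)) * ((t + u) * contF (t - u) (q + 1)) *
      ((t + u) * contF (t - u) (r + 1)))
  + 2 * (t + u) ^ 2 * (α * β * ((t + u) * contF (t - u) (r + 2))
    + α * γ * ((t + u) * contF (t - u) (q + 2))
    + β * γ * ((t + u) * contF (t - u) (p + 2))) := by
    unfold thForm
    rw [hp, hq, hr]
    ring
  rw [E1, a2, a1, a0, b2, b1, b0, c2, c1, c0]
  have m1 : (T (a + b + c) : LaurentPolynomial ℚ) = T a * T b * T c := by
    simp only [← T_add]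
  have m2 : (T (b + c - a) : LaurentPolynomial ℚ) = T (-a) * T b * T c := by
    simp only [← T_add]; congr 1; ring
  have m3 : (T (a + c - b) : LaurentPolynomial ℚ) = T a * T (-b) * T c := by
    simp only [← T_add]; congr 1; ring
  have m4 : (T (a + b - c) : LaurentPolynomial ℚ) = T a * T b * T (-c) := by
    simp only [← T_add]; congr 1
  have m5 : (T (c - a - b) : LaurentPolynomial ℚ) = T (-a) * T (-b) * T c := by
    simp only [← T_add]; congr 1; ring
  have m6 : (T (b - a - c) : LaurentPolynomial ℚ) = T (-a) * T b * T (-c) := by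
    simp only [← T_add]; congr 1; ring
  have m7 : (T (a - b - c) : LaurentPolynomial ℚ) = T a * T (-b) * T (-c) := by
    simp only [← T_add]; congr 1
  have m8 : (T (- a - b - c) : LaurentPolynomial ℚ) = T (-a) * T (-b) * T (-c) := by
    simp only [← T_add]; congr 1
  rw [m1, m2, m3, m4, m5, m6, m7, m8]
  clear * -
  generalize (T a : LaurentPolynomial ℚ) = A
  generalize (T b : LaurentPolynomial ℚ) = B
  generalize (T c : LaurentPolynomial ℚ) = C
  generalize (T (-a) : LaurentPolynomial ℚ) = A'
  generalize (T (-b) : LaurentPolynomial ℚ) = B'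
  generalize (T (-c) : LaurentPolynomial ℚ) = C'
  ring

end Laurent

/-! ### Comparing coefficients -/

section Compare

/-- Kronecker delta. -/
def dl (n e : ℤ) : ℤ := if n = e then 1 else 0

/-- The sign `(-1)^n`. -/
def sg (n : ℤ) : ℤ := if n % 2 = 0 then 1 else -1

/-- The part of the coefficient at `e` that does not depend on `a + b + c` only. -/
def lowK (a b c e : ℤ) : ℤ :=
  - sg c * (dl (a + b - c) e - 2 * dl (a + b - c - 1) e + dl (a + b - c - 2) e)
  + 2 * (sg b * sg c * dl (a + 2) e + sg a * sg c * dl (b + 2) e + sg a * sg b * dl (c + 2) e)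

/-- The part of the coefficient at `e` depending on `s = a + b + c`. -/
def topK (s e : ℤ) : ℤ :=
  dl (s + 2) e - 2 * dl (s + 1) e + 5 * dl s e - 4 * dl (s - 1) e + 4 * dl (s - 2) e

theorem dl_self (n e : ℤ) (h : n = e) : dl n e = 1 := if_pos h

theorem dl_ne (n e : ℤ) (h : n ≠ e) : dl n e = 0 := if_neg h

theorem sg_mul_self (n m : ℤ) (h : (n - m) % 2 = 0) : sg n * sg m = 1 := by
  unfold sg; split_ifs <;> omega

theorem sg_mul_neg (n m : ℤ) (h : (n - m) % 2 = 1) : sg n * sg m = -1 := by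
  unfold sg; split_ifs <;> omega

theorem sg_cases (n : ℤ) : (n % 2 = 0 ∧ sg n = 1) ∨ (n % 2 = 1 ∧ sg n = -1) := by
  unfold sg; split_ifs <;> omega

theorem lowK_top (a b c : ℤ) (hc : 1 ≤ c) (hbc : c ≤ b) (hab : b ≤ a) :
    ∃ t, a + 2 ≤ t ∧ (∀ e, t < e → lowK a b c e = 0) ∧
    ((c + 2 < b ∧ t = a + b - c ∧ lowK a b c t = - sg c) ∨
     (b = c + 2 ∧ b < a ∧ t = a + 2 ∧ lowK a b c t = 2 - sg c) ∨
     (b = c + 2 ∧ b = a ∧ t = a + 2 ∧ lowK a b c t = 4 - sg c) ∨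
     (b = c + 1 ∧ b < a ∧ t = a + 2 ∧ lowK a b c t = -2) ∨
     (b = c + 1 ∧ b = a ∧ t = a + 2 ∧ lowK a b c t = -4) ∨
     (b = c ∧ b < a ∧ t = a + 2 ∧ lowK a b c t = 2) ∨
     (b = c ∧ b = a ∧ t = a + 2 ∧ lowK a b c t = 6)) := by
  by_cases h1 : c + 2 < b
  · refine ⟨a + b - c, by omega, fun e he => ?_, Or.inl ⟨h1, rfl, ?_⟩⟩
    · unfold lowK
      simp (disch := omega) only [dl_ne]
      ring
    · unfold lowK
      simp (disch := omega) only [dl_ne, dl_self]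
      ring
  · refine ⟨a + 2, by omega, fun e he => ?_, Or.inr ?_⟩
    · unfold lowK
      simp (disch := omega) only [dl_ne]
      ring
    · obtain h | h | h : b = c + 2 ∨ b = c + 1 ∨ b = c := by omega
      · rcases hab.lt_or_eq with h' | h'
        · refine Or.inl ⟨h, h', rfl, ?_⟩
          unfold lowK
          simp (disch := omega) only [dl_ne, dl_self, sg_mul_self]
          ring
        · refine Or.inr (Or.inl ⟨h, h', rfl, ?_⟩)
          unfold lowK
          simp (disch := omega) only [dl_ne, dl_self, sg_mul_self]
          ring
      · rcases hab.lt_or_eq with h' | h'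
        · refine Or.inr (Or.inr (Or.inl ⟨h, h', rfl, ?_⟩))
          unfold lowK
          simp (disch := omega) only [dl_ne, dl_self, sg_mul_neg]
          ring
        · refine Or.inr (Or.inr (Or.inr (Or.inl ⟨h, h', rfl, ?_⟩)))
          unfold lowK
          simp (disch := omega) only [dl_ne, dl_self, sg_mul_neg]
          ring
      · rcases hab.lt_or_eq with h' | h'
        · refine Or.inr (Or.inr (Or.inr (Or.inr (Or.inl ⟨h, h', rfl, ?_⟩))))
          unfold lowK
          simp (disch := omega) only [dl_ne, dl_self, sg_mul_self]
          ring
        · refine Or.inr (Or.inr (Or.inr (Or.inr (Or.inr ⟨h, h', rfl, ?_⟩))))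
          unfold lowK
          simp (disch := omega) only [dl_ne, dl_self, sg_mul_self]
          ring

theorem sum_le (a b c a' b' c' : ℤ) (hc : 1 ≤ c) (hbc : c ≤ b) (hab : b ≤ a)
    (hc' : 1 ≤ c') (hbc' : c' ≤ b') (hab' : b' ≤ a')
    (H : ∀ e, a + 2 ≤ e → a' + 2 ≤ e →
      topK (a + b + c) e + lowK a b c e = topK (a' + b' + c') e + lowK a' b' c' e) :
    a + b + c ≤ a' + b' + c' := by
  by_contra hlt
  have := H (a + b + c + 2) (by omega) (by omega)
  unfold topK lowK at this
  simp (disch := omega) only [dl_ne, dl_self] at this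
  omega

theorem a_le (a b c a' b' : ℤ) (hbc : c < b) (hab : b ≤ a) (hab' : b' ≤ a')
    (hbc' : c < b') (hs : a + b = a' + b')
    (H : ∀ e, a + 2 ≤ e → a' + 2 ≤ e → lowK a b c e = lowK a' b' c e) : a ≤ a' := by
  by_contra hlt
  have h1 := H (a + 2) (by omega) (by omega)
  unfold lowK at h1
  rw [← hs] at h1
  have h2 : sg b * sg c * dl (a + 2) (a + 2) + sg a * sg c * dl (b + 2) (a + 2)
      + sg a * sg b * dl (c + 2) (a + 2)
      = sg b' * sg c * dl (a' + 2) (a + 2) + sg a' * sg c * dl (b' + 2) (a + 2)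
      + sg a' * sg b' * dl (c + 2) (a + 2) := by omega
  rcases hab.lt_or_eq with h' | h'
  · simp (disch := omega) only [dl_ne, dl_self] at h2
    rcases sg_cases b with ⟨_, h3⟩ | ⟨_, h3⟩ <;> rcases sg_cases c with ⟨_, h4⟩ | ⟨_, h4⟩ <;>
      rw [h3, h4] at h2 <;> omega
  · subst h'
    simp (disch := omega) only [dl_ne, dl_self] at h2
    rcases sg_cases b with ⟨_, h3⟩ | ⟨_, h3⟩ <;> rcases sg_cases c with ⟨_, h4⟩ | ⟨_, h4⟩ <;>
      rw [h3, h4] at h2 <;> omega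

theorem compareTriples (a b c a' b' c' : ℤ) (hc : 1 ≤ c) (hbc : c ≤ b) (hab : b ≤ a)
    (hc' : 1 ≤ c') (hbc' : c' ≤ b') (hab' : b' ≤ a')
    (H : ∀ e, a + 2 ≤ e → a' + 2 ≤ e →
      topK (a + b + c) e + lowK a b c e = topK (a' + b' + c') e + lowK a' b' c' e) :
    a = a' ∧ b = b' ∧ c = c' := by
  have hs : a + b + c = a' + b' + c' := le_antisymm
    (sum_le a b c a' b' c' hc hbc hab hc' hbc' hab' H)
    (sum_le a' b' c' a b c hc' hbc' hab' hc hbc hab fun e h1 h2 => (H e h2 h1).symm)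
  have H' : ∀ e, a + 2 ≤ e → a' + 2 ≤ e → lowK a b c e = lowK a' b' c' e := by
    intro e h1 h2
    have := H e h1 h2
    rw [hs] at this
    omega
  obtain ⟨t, ht, hz, D⟩ := lowK_top a b c hc hbc hab
  obtain ⟨t', ht', hz', D'⟩ := lowK_top a' b' c' hc' hbc' hab'
  have S := sg_cases c
  have S' := sg_cases c'
  have hne : lowK a b c t ≠ 0 := by omega
  have hne' : lowK a' b' c' t' ≠ 0 := by omega
  have htt : t = t' := by
    rcases lt_trichotomy t t' with h | h | h
    · exact absurd ((H' t' (by omega) (by omega)).symm.trans (hz t' h)) hne'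
    · exact h
    · exact absurd ((H' t (by omega) (by omega)).trans (hz' t h)) hne
  subst htt
  have hv := H' t ht ht'
  by_cases hbig : c + 2 < b ∧ c' + 2 < b'
  · have hcc : c = c' := by omega
    subst hcc
    have h1 := a_le a b c a' b' (by omega) hab hab' (by omega) (by omega) H'
    have h2 := a_le a' b' c a b (by omega) hab' hab (by omega) (by omega)
      fun e h1 h2 => (H' e h2 h1).symm
    omega
  · generalize lowK a b c t = v at *
    generalize lowK a' b' c' t = v' at *
    clear H H' hz hz' hne hne'
    rcases D with D | D | D | D | D | D | D <;> rcases D' with D' | D' | D' | D' | D' | D' | D' <;>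
      omega

end Compare

/-! ### Extracting coefficients and conclusion -/

section Extract

open LaurentPolynomial in
theorem coeff_CT (k : ℚ) (n e : ℤ) :
    (LaurentPolynomial.C k * T n : LaurentPolynomial ℚ).coeff e = k * (dl n e : ℚ) := by
  rw [← LaurentPolynomial.single_eq_C_mul_T]
  simp only [dl, AddMonoidAlgebra.coeff_single, Finsupp.single_apply]
  split_ifs <;> simp

open LaurentPolynomial in
theorem coeff_CW (P : LaurentPolynomial ℚ) (k : ℚ) (n e : ℤ) (k2 k1 k0 m1 m2 : ℚ)
    (hP : P = LaurentPolynomial.C k2 * T 2 + LaurentPolynomial.C k1 * T 1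
      + LaurentPolynomial.C k0 * T 0
      + LaurentPolynomial.C m1 * T (-1) + LaurentPolynomial.C m2 * T (-2)) :
    (LaurentPolynomial.C k * (T n * P) : LaurentPolynomial ℚ).coeff e =
      k * (k2 * (dl (n + 2) e : ℚ) + k1 * (dl (n + 1) e : ℚ) + k0 * (dl n e : ℚ)
        + m1 * (dl (n - 1) e : ℚ) + m2 * (dl (n - 2) e : ℚ)) := by
  have E : (LaurentPolynomial.C k * (T n * P) : LaurentPolynomial ℚ) =
      LaurentPolynomial.C (k * k2) * T (n + 2) + LaurentPolynomial.C (k * k1) * T (n + 1)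
      + LaurentPolynomial.C (k * k0) * T n
      + LaurentPolynomial.C (k * m1) * T (n - 1) + LaurentPolynomial.C (k * m2) * T (n - 2) := by
    rw [hP]
    simp only [sub_eq_add_neg, T_add, map_mul, T_zero]
    ring
  rw [E]
  simp only [AddMonoidAlgebra.coeff_add, Finsupp.add_apply, coeff_CT]
  ring

theorem sg_pow (p : ℕ) :
    ((-1) ^ (p + 1) : LaurentPolynomial ℚ) = LaurentPolynomial.C ((sg (p + 1) : ℤ) : ℚ) := by
  have : ((sg (p + 1) : ℤ) : ℚ) = (-1) ^ (p + 1) := by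
    unfold sg
    split_ifs with h
    · rw [Even.neg_one_pow (Nat.even_iff.2 (by omega))]; simp
    · rw [Odd.neg_one_pow (Nat.odd_iff.2 (by omega))]; simp
  rw [this]
  simp

open LaurentPolynomial in
theorem coeff_thForm (p q r : ℕ) (a b c : ℤ) (ha : a = p + 1) (hb : b = q + 1) (hc : c = r + 1)
    (hbc : c ≤ b) (hab : b ≤ a) (e : ℤ) (he : a + 2 ≤ e) :
    ((T 1 + T (-1) : LaurentPolynomial ℚ) ^ 3 *
      thForm (T 1 - T (-1)) (T 1 - T (-1) - 1) p q r).coeff e =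
      ((topK (a + b + c) e + lowK a b c e : ℤ) : ℚ) := by
  rw [thForm_laurent p q r a b c ha hb hc _ _ _ (sg_pow p).symm (sg_pow q).symm (sg_pow r).symm
    _ _ rfl rfl, ← ha, ← hb, ← hc]
  have htu := lt_tu
  have t2 : (T 2 : LaurentPolynomial ℚ) = T 1 * T 1 := by rw [← T_add]; rfl
  have u2 : (T (-2) : LaurentPolynomial ℚ) = T (-1) * T (-1) := by rw [← T_add]; rfl
  have W1 := fun k n => coeff_CW ((T 1 + 2 * T (-1) - 1) ^ 2) k n e 1 (-2) 5 (-4) 4 (by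
    simp only [t2, u2, T_zero, map_neg, map_one, map_ofNat]
    linear_combination 4 * htu)
  have W2 := fun k n => coeff_CW ((T (-1) - 1) ^ 2) k n e 0 0 1 (-2) 1 (by
    simp only [t2, u2, T_zero, map_neg, map_one, map_ofNat, map_zero]
    ring)
  have W3 := fun k n => coeff_CW ((T 1 + 1) ^ 2) k n e 1 2 1 0 0 (by
    simp only [t2, u2, T_zero, map_neg, map_one, map_ofNat, map_zero]
    ring)
  have W4 := fun k n => coeff_CW ((2 * T 1 + T (-1) + 1) ^ 2) k n e 4 4 5 2 1 (by
    simp only [t2, u2, T_zero, map_neg, map_one, map_ofNat, map_zero]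
    linear_combination 4 * htu)
  have W5 := fun k n => coeff_CW ((T 1 + T (-1)) ^ 2) k n e 1 0 2 0 1 (by
    simp only [t2, u2, T_zero, map_neg, map_one, map_ofNat, map_zero]
    linear_combination 2 * htu)
  have one : ∀ x : LaurentPolynomial ℚ, x = LaurentPolynomial.C 1 * x := by simp
  have two : (2 : LaurentPolynomial ℚ) = LaurentPolynomial.C 2 :=
    (map_ofNat LaurentPolynomial.C 2).symm
  rw [one (T (a + b + c) * _)]
  generalize (T 1 + 2 * T (-1) - 1 : LaurentPolynomial ℚ) ^ 2 = P1 at *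
  generalize (T (-1) - 1 : LaurentPolynomial ℚ) ^ 2 = P2 at *
  generalize (T 1 + 1 : LaurentPolynomial ℚ) ^ 2 = P3 at *
  generalize (2 * T 1 + T (-1) + 1 : LaurentPolynomial ℚ) ^ 2 = P4 at *
  generalize (T 1 + T (-1) : LaurentPolynomial ℚ) ^ 2 = P5 at *
  rw [two]
  simp only [← map_mul, AddMonoidAlgebra.coeff_add, AddMonoidAlgebra.coeff_sub,
    Finsupp.add_apply, Finsupp.sub_apply, W1, W2, W3, W4, W5]
  unfold topK lowK
  simp (disch := omega) only [dl_ne (b + c - a), dl_ne (b + c - a - 1), dl_ne (b + c - a - 2),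
    dl_ne (a + c - b), dl_ne (a + c - b - 1), dl_ne (a + c - b - 2),
    dl_ne (c - a - b), dl_ne (c - a - b + 1), dl_ne (c - a - b + 2),
    dl_ne (b - a - c), dl_ne (b - a - c + 1), dl_ne (b - a - c + 2),
    dl_ne (a - b - c), dl_ne (a - b - c + 1), dl_ne (a - b - c + 2),
    dl_ne (-a - b - c), dl_ne (-a - b - c + 1), dl_ne (-a - b - c + 2),
    dl_ne (-a - b - c - 1), dl_ne (-a - b - c - 2),
    dl_ne (-a + 2), dl_ne (-a), dl_ne (-a - 2),
    dl_ne (-b + 2), dl_ne (-b), dl_ne (-b - 2),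
    dl_ne (-c + 2), dl_ne (-c), dl_ne (-c - 2),
    dl_ne a, dl_ne b, dl_ne c, dl_ne (a - 2), dl_ne (b - 2), dl_ne (c - 2)]
  push_cast
  ring

/-- The substitution `x ↦ 2 + t - t⁻¹`. -/
def substHom : ℚ[X] →+* LaurentPolynomial ℚ :=
  Polynomial.eval₂RingHom LaurentPolynomial.C
    (LaurentPolynomial.T 1 - LaurentPolynomial.T (-1) + 2)

open LaurentPolynomial in
theorem substHom_thForm (p q r : ℕ) :
    substHom (thForm (Polynomial.X - 2 : ℚ[X]) (Polynomial.X - 3) p q r) =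
      thForm (T 1 - T (-1)) (T 1 - T (-1) - 1) p q r := by
  have h : substHom Polynomial.X = T 1 - T (-1) + 2 := by
    simp [substHom]
  rw [map_thForm, map_sub, map_sub, h, map_ofNat, map_ofNat]
  congr 1
  · ring
  · ring

end Extract

/-- **Lemma 4.4.** No two non-isomorphic graphs of the form `θ(p,q,r)` share the same
signless Laplacian permanental polynomial. -/
theorem thetaGraph_qPermPoly_injective
    (p q r p' q' r' : ℕ) (h0 : (0 < p ∧ 0 < q) ∨ (0 < p ∧ 0 < r) ∨ (0 < q ∧ 0 < r))
    (h0' : (0 < p' ∧ 0 < q') ∨ (0 < p' ∧ 0 < r') ∨ (0 < q' ∧ 0 < r'))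
    (h : qPermPoly (thetaGraph p q r) = qPermPoly (thetaGraph p' q' r')) :
    Nonempty (thetaGraph p q r ≃g thetaGraph p' q' r') := by
  obtain ⟨a, b, c, h1, h2, h3, ⟨e⟩, h5⟩ := theta_sort p q r h0
  obtain ⟨a', b', c', h1', h2', h3', ⟨e'⟩, h5'⟩ := theta_sort p' q' r' h0'
  rw [qPermPoly_theta p q r h0, qPermPoly_theta p' q' r' h0', h5, h5'] at h
  have hL := congrArg substHom h
  rw [substHom_thForm, substHom_thForm] at hL
  obtain ⟨k1, k2, k3⟩ := compareTriples (a + 1) (b + 1) (c + 1) (a' + 1) (b' + 1) (c' + 1)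
    (by omega) (by omega) (by omega) (by omega) (by omega) (by omega) (by
      intro x hx hx'
      have E1 := coeff_thForm a b c _ _ _ rfl rfl rfl (by omega) (by omega) x hx
      have E2 := coeff_thForm a' b' c' _ _ _ rfl rfl rfl (by omega) (by omega) x hx'
      rw [hL, E2] at E1
      exact_mod_cast E1.symm)
  obtain rfl : a = a' := by omega
  obtain rfl : b = b' := by omega
  obtain rfl : c = c' := by omega
  exact ⟨e.trans e'.symm⟩
end
end

section
/- Let p, q ≥ 3 and r ≥ 1 be integers. Then the Laplacian permanental polynomial of d(p,q,r) evaluated at x = 2 satisfies per(2I − L(d(p,q,r))) = 9/2 + (3/2)(−1)^p + (3/2)(−1)^q + (1/2)(−1)^{p+q} + 2(−1)^{q+r} + 2(−1)^r + 2(−1)^{p+r} + 2(−1)^{p+q+r}. -/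
open scoped Classical
open Polynomial

noncomputable section

/-- The Laplacian permanental polynomial of `G` evaluated at `x = 2`:
`per(2·I − L(G))`. -/
def lapPermAtTwo {V : Type*} [Fintype V] (G : SimpleGraph V) : ℚ :=
  Matrix.permanent (Matrix.diagonal (fun _ : V => (2 : ℚ)) - G.lapMatrix ℚ)

/-- The bicyclic graph `d(p,q,r)` on `p + q + r` vertices: vertices `0, …, p-1` form the
cycle `C_p`, vertices `p, …, p+q-1` form the cycle `C_q`, and vertices `p+q, …, p+q+r-1`
form a path of `r` internal vertices whose ends are joined to vertex `0` of `C_p` and to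
vertex `p` of `C_q` (i.e. a path on `r + 2` vertices has each end vertex identified with a
vertex of one of the two cycles). -/
def dGraph (p q r : ℕ) : SimpleGraph (Fin (p + q + r)) :=
  SimpleGraph.fromRel (fun i j =>
    (i.val + 1 = j.val ∧ j.val < p) ∨
    (i.val = p - 1 ∧ j.val = 0) ∨
    (i.val + 1 = j.val ∧ p ≤ i.val ∧ j.val < p + q) ∨
    (i.val = p + q - 1 ∧ j.val = p) ∨
    (i.val + 1 = j.val ∧ p + q ≤ i.val) ∨
    (i.val = 0 ∧ j.val = p + q) ∨
    (i.val = p + q + r - 1 ∧ j.val = p))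


section helpers

/-- Reindexing both sides by an equivalence preserves the permanent. -/
theorem perm_reindex {m n : Type*} [Fintype m] [DecidableEq m] [Fintype n] [DecidableEq n]
    (e : m ≃ n) (M : Matrix n n ℚ) : (M.submatrix e e).permanent = M.permanent := by
  unfold Matrix.permanent
  refine Fintype.sum_equiv (Equiv.permCongr e) _ _ fun σ => ?_
  refine Fintype.prod_equiv e _ _ fun i => ?_
  simp [Equiv.permCongr_apply]

/-- Additivity of the permanent in one row. -/
theorem perm_row_add {V : Type*} [Fintype V] [DecidableEq V] (N : Matrix V V ℚ) (d : V)
    (u : V → ℚ) :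
    Matrix.permanent (fun v w => N v w + if v = d then u w else 0)
      = N.permanent + Matrix.permanent (fun v w => if v = d then u w else N v w) := by
  unfold Matrix.permanent
  rw [← Finset.sum_add_distrib]
  refine Finset.sum_congr rfl fun σ _ => ?_
  have key : ∀ i ∈ (Finset.univ : Finset V).erase (σ.symm d), σ i ≠ d := by
    intro i hi h
    exact (Finset.ne_of_mem_erase hi) (by rw [← h]; simp)
  rw [← Finset.mul_prod_erase _ _ (Finset.mem_univ (σ.symm d)),
    ← Finset.mul_prod_erase (a := σ.symm d) _ (fun i => N (σ i) i) (Finset.mem_univ _),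
    ← Finset.mul_prod_erase (a := σ.symm d) _ (fun i => if σ i = d then u i else N (σ i) i)
      (Finset.mem_univ _)]
  rw [Finset.prod_congr rfl (g := fun i => N (σ i) i) (fun i hi => by simp [key i hi]),
    Finset.prod_congr (s₁ := (Finset.univ : Finset V).erase (σ.symm d)) rfl
      (f := fun i => if σ i = d then u i else N (σ i) i)
      (g := fun i => N (σ i) i) (fun i hi => by simp [key i hi])]
  simp only [Equiv.apply_symm_apply, if_true]
  ring

/-- If column `none` has exactly two ones, in rows `none` and `some d`, then one may delete
that column and merge the two rows. -/
theorem perm_merge {V : Type*} [Fintype V] [DecidableEq V]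
    (A : Matrix (Option V) (Option V) ℚ) (d : V) (h0 : A none none = 1)
    (h1 : ∀ v, A (some v) none = if v = d then 1 else 0) :
    A.permanent = Matrix.permanent
      (fun v w : V => A (some v) (some w) + if v = d then A none (some w) else 0) := by
  rw [perm_row_add (fun v w : V => A (some v) (some w)) d (fun w => A none (some w))]
  unfold Matrix.permanent
  rw [← Equiv.sum_comp Equiv.Perm.decomposeOption.symm, Fintype.sum_prod_type,
    Fintype.sum_option]
  congr 1
  · refine Finset.sum_congr rfl fun σ _ => ?_
    rw [Fintype.prod_option]
    simp [h0]
  · rw [Finset.sum_eq_single d]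
    · refine Finset.sum_congr rfl fun σ _ => ?_
      rw [Fintype.prod_option]
      simp only [Equiv.Perm.decomposeOption_symm_apply, Equiv.Perm.coe_mul, Function.comp,
        Equiv.optionCongr_apply, Option.map_none, Option.map_some, Equiv.swap_apply_left, h1,
        if_true, one_mul]
      refine Finset.prod_congr rfl fun i _ => ?_
      by_cases h : σ i = d
      · simp [h]
      · rw [Equiv.swap_apply_of_ne_of_ne (by simp) (by simpa using h)]
        simp [h]
    · intro b _ hb
      refine Finset.sum_eq_zero fun σ _ => ?_
      rw [Fintype.prod_option]
      simp [h1, hb]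
    · simp

/-- Contracting two consecutive vertices of degree two. -/
theorem perm_contract {V : Type*} [Fintype V] [DecidableEq V]
    (M : Matrix (Option (Option V)) (Option (Option V)) ℚ) (a d : V)
    (hbb : M none none = 0) (hbc : M none (some none) = 1) (hcb : M (some none) none = 1)
    (hcc : M (some none) (some none) = 0)
    (hvb : ∀ v, M (some (some v)) none = if v = a then 1 else 0)
    (hvc : ∀ v, M (some (some v)) (some none) = if v = d then 1 else 0)
    (hbv : ∀ v, M none (some (some v)) = if v = a then 1 else 0)
    (hcv : ∀ v, M (some none) (some (some v)) = if v = d then 1 else 0) :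
    M.permanent = Matrix.permanent (fun v w : V => M (some (some v)) (some (some w))
      + (if v = a ∧ w = d then 1 else 0) + (if v = d ∧ w = a then 1 else 0)) := by
  have hs : ∀ v : V, Equiv.swap (none : Option (Option V)) (some none) (some (some v))
      = some (some v) := fun v => Equiv.swap_apply_of_ne_of_ne (by simp) (by simp)
  rw [← Matrix.permanent_permute_cols (Equiv.swap none (some none)) M]
  refine (perm_merge _ (some a) ?_ ?_).trans ?_
  rotate_left 2
  · refine (perm_merge _ d ?_ ?_).trans ?_
    rotate_left 2
    · congr 1
      funext v w
      simp only [Matrix.submatrix_apply, hs, id, Equiv.swap_apply_left, Equiv.swap_apply_right,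
        hbv, hcv, Option.some.injEq, reduceCtorEq, if_false, add_zero]
      split_ifs <;> simp_all
    · simp [hbc]
    · intro v
      simp [hs, hvc, hcc]
  · simp [hcb]
  · rintro (_ | v)
    · simp [hbb]
    · simp [hs, hvb]

/-- Attach to the weighted graph `N` a path with `k` internal vertices joining `a` and `d`. -/
def attach {V : Type} [DecidableEq V] (N : Matrix V V ℚ) (a d : V) (k : ℕ) :
    Matrix (V ⊕ Fin k) (V ⊕ Fin k) ℚ
  | .inl v, .inl w => N v w +
      ((if k = 0 ∧ v = a ∧ w = d then 1 else 0) + (if k = 0 ∧ v = d ∧ w = a then 1 else 0))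
  | .inl v, .inr i =>
      (if v = a ∧ i.val = 0 then 1 else 0) + (if v = d ∧ i.val + 1 = k then 1 else 0)
  | .inr i, .inl v =>
      (if v = a ∧ i.val = 0 then 1 else 0) + (if v = d ∧ i.val + 1 = k then 1 else 0)
  | .inr i, .inr j =>
      (if i.val + 1 = j.val then 1 else 0) + (if j.val + 1 = i.val then 1 else 0)

/-- The equivalence singling out the last two path vertices. -/
def lastTwo (V : Type) (k : ℕ) : Option (Option (V ⊕ Fin k)) ≃ V ⊕ Fin (k + 2) :=
  Equiv.ofBijective
    (fun
      | none => .inr ⟨k, by omega⟩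
      | some none => .inr ⟨k + 1, by omega⟩
      | some (some (.inl v)) => .inl v
      | some (some (.inr i)) => .inr ⟨i.val, by omega⟩)
    (by
      constructor
      · rintro (_ | _ | v | i) (_ | _ | w | j) h <;>
          simp [Fin.ext_iff] at h ⊢ <;> omega
      · rintro (v | ⟨i, hi⟩)
        · exact ⟨some (some (.inl v)), rfl⟩
        · by_cases h : i < k
          · exact ⟨some (some (.inr ⟨i, h⟩)), rfl⟩
          · by_cases h' : i = k
            · exact ⟨none, by simp [h']⟩
            · exact ⟨some none, by simp; omega⟩)

theorem lastTwo_none (V : Type) (k : ℕ) : lastTwo V k none = .inr ⟨k, by omega⟩ := rfl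
theorem lastTwo_some_none (V : Type) (k : ℕ) :
    lastTwo V k (some none) = .inr ⟨k + 1, by omega⟩ := rfl
theorem lastTwo_inl (V : Type) (k : ℕ) (v : V) :
    lastTwo V k (some (some (.inl v))) = .inl v := rfl
theorem lastTwo_inr (V : Type) (k : ℕ) (i : Fin k) :
    lastTwo V k (some (some (.inr i))) = .inr ⟨i.val, by omega⟩ := rfl

theorem attach_step {V : Type} [Fintype V] [DecidableEq V] (N : Matrix V V ℚ) (a d : V) (k : ℕ) :
    (attach N a d (k + 2)).permanent = (attach N a d k).permanent := by
  rw [← perm_reindex (lastTwo V k)]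
  obtain ⟨a', ha1, ha2⟩ : ∃ a' : V ⊕ Fin k, (∀ v, Sum.inl v = a' ↔ v = a ∧ k = 0) ∧
      (∀ i : Fin k, Sum.inr i = a' ↔ i.val + 1 = k) := by
    by_cases h : k = 0
    · subst h
      exact ⟨.inl a, by simp, fun i => i.elim0⟩
    · refine ⟨.inr ⟨k - 1, by omega⟩, by simp [h], fun i => ?_⟩
      simp only [Sum.inr.injEq, Fin.ext_iff]
      omega
  refine (perm_contract _ a' (.inl d) ?_ ?_ ?_ ?_ ?_ ?_ ?_ ?_).trans ?_
  rotate_left 8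
  · congr 1
    funext x y
    rcases x with v | ⟨i, hi⟩ <;> rcases y with w | ⟨j, hj⟩ <;>
      simp only [Matrix.submatrix_apply, lastTwo_none, lastTwo_some_none, lastTwo_inl,
        lastTwo_inr, attach, ha1, ha2, Sum.inl.injEq, reduceCtorEq] <;> grind
  all_goals first
    | rintro (v | ⟨i, hi⟩)
    | skip
  all_goals
    simp only [Matrix.submatrix_apply, lastTwo_none, lastTwo_some_none, lastTwo_inl,
        lastTwo_inr, attach, ha1, ha2, Sum.inl.injEq, reduceCtorEq]
  all_goals grind

theorem sum_ind (k c : ℕ) :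
    ∑ j : Fin k, (if j.val = c then (1 : ℚ) else 0) = if c < k then 1 else 0 := by
  by_cases h : c < k
  · rw [Finset.sum_eq_single ⟨c, h⟩]
    · simp [h]
    · intro b _ hb
      rw [if_neg]
      intro h'
      exact hb (Fin.ext h')
    · simp
  · rw [if_neg h]
    refine Finset.sum_eq_zero fun j _ => if_neg ?_
    have := j.isLt
    omega

/-- Row sums after attaching a path. -/
theorem attach_sum_inl {V : Type} [Fintype V] [DecidableEq V] (N : Matrix V V ℚ) (a d : V) (k : ℕ)
    (v : V) : ∑ y, attach N a d k (.inl v) y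
      = ∑ w, N v w + ((if v = a then 1 else 0) + (if v = d then 1 else 0)) := by
  rw [Fintype.sum_sum_type]
  simp only [attach, Finset.sum_add_distrib, ite_and]
  rcases k with _ | k
  · simp
  · have h1 := sum_ind (k + 1) 0
    have h2 := sum_ind (k + 1) k
    rw [if_pos (by omega)] at h1 h2
    have e1 : ∑ x : Fin (k + 1), (if v = a then if x.val = 0 then (1 : ℚ) else 0 else 0)
        = if v = a then 1 else 0 := by
      by_cases h : v = a
      · simp only [if_pos h, h1]
      · simp only [if_neg h, Finset.sum_const_zero]
    have e2 : ∑ x : Fin (k + 1), (if v = d then if x.val + 1 = k + 1 then (1 : ℚ) else 0 else 0)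
        = if v = d then 1 else 0 := by
      by_cases h : v = d
      · simp only [if_pos h, Nat.add_right_cancel_iff, h2]
      · simp only [if_neg h, Finset.sum_const_zero]
    rw [e1, e2]
    simp

theorem attach_sum_inr {V : Type} [Fintype V] [DecidableEq V] (N : Matrix V V ℚ) (a d : V) (k : ℕ)
    (i : Fin k) : ∑ y, attach N a d k (.inr i) y = 2 := by
  rw [Fintype.sum_sum_type]
  obtain ⟨i, hi⟩ := i
  have h1 := sum_ind k (i + 1)
  have h2 : ∑ j : Fin k, (if j.val + 1 = i then (1 : ℚ) else 0) = if 0 < i then 1 else 0 := by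
    rcases i with _ | i
    · simp
    · simp only [Nat.add_right_cancel_iff, sum_ind]
      rw [if_pos (by omega)]
      simp
  simp only [attach, Finset.sum_add_distrib, ite_and, eq_comm (a := i + 1) (b := Fin.val _),
    h1, h2, Finset.sum_ite_eq', Finset.mem_univ, if_true]
  split_ifs <;> first | omega | norm_num

theorem attach_comm {V : Type} [DecidableEq V] (N : Matrix V V ℚ) (a d b c : V) (k m : ℕ) :
    attach (attach N a d k) (.inl b) (.inl c) m =
      (attach (attach N b c m) (.inl a) (.inl d) k).submatrix
        ((Equiv.sumAssoc V (Fin k) (Fin m)).trans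
            ((Equiv.sumCongr (Equiv.refl V) (Equiv.sumComm (Fin k) (Fin m))).trans
              (Equiv.sumAssoc V (Fin m) (Fin k)).symm))
        ((Equiv.sumAssoc V (Fin k) (Fin m)).trans
            ((Equiv.sumCongr (Equiv.refl V) (Equiv.sumComm (Fin k) (Fin m))).trans
              (Equiv.sumAssoc V (Fin m) (Fin k)).symm)) := by
  funext x y
  rcases x with (v | i) | i <;> rcases y with (w | j) | j <;>
    simp [attach, Equiv.sumAssoc] <;> ring

theorem attach_submatrix {V W : Type} [DecidableEq V] [DecidableEq W] (e : V ≃ W)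
    (N : Matrix W W ℚ) (a d : V) (k : ℕ) :
    attach (N.submatrix e e) a d k =
      (attach N (e a) (e d) k).submatrix (Equiv.sumCongr e (Equiv.refl (Fin k)))
        (Equiv.sumCongr e (Equiv.refl (Fin k))) := by
  funext x y
  rcases x with v | i <;> rcases y with w | j <;> simp [attach]

/-- The two branch vertices, each carrying weight `s`. -/
def base (s : ℚ) : Matrix (Fin 2) (Fin 2) ℚ := fun i j => if i = j then s else 0

/-- The weighted graph `d(p+1,q+1,r)`. -/
def dMat (s : ℚ) (p q r : ℕ) :
    Matrix (((Fin 2 ⊕ Fin p) ⊕ Fin q) ⊕ Fin r) (((Fin 2 ⊕ Fin p) ⊕ Fin q) ⊕ Fin r) ℚ :=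
  attach (attach (attach (base s) 0 0 p) (.inl 1) (.inl 1) q) (.inl (.inl 0)) (.inl (.inl 1)) r

theorem dMat_r (s : ℚ) (p q r : ℕ) :
    (dMat s p q (r + 2)).permanent = (dMat s p q r).permanent := attach_step _ _ _ _

theorem dMat_q (s : ℚ) (p q r : ℕ) :
    (dMat s p (q + 2) r).permanent = (dMat s p q r).permanent := by
  unfold dMat
  rw [attach_comm, perm_reindex, attach_step, attach_comm _ _ _ _ _ q r, perm_reindex]

theorem dMat_swap (s : ℚ) (p q r : ℕ) :
    (dMat s p q r).permanent = (attach (attach (attach (base s) 1 1 q) (.inl 0) (.inl 0) p)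
      (.inl (.inl 0)) (.inl (.inl 1)) r).permanent := by
  unfold dMat
  rw [attach_comm (base s), attach_submatrix, perm_reindex]
  rfl

theorem dMat_p (s : ℚ) (p q r : ℕ) :
    (dMat s (p + 2) q r).permanent = (dMat s p q r).permanent := by
  rw [dMat_swap, dMat_swap]
  rw [attach_comm, perm_reindex, attach_step, attach_comm _ _ _ _ _ p r, perm_reindex]

theorem dMat_value (p q r : ℕ) : (dMat (-1) p q r).permanent =
    9/2 + (3/2) * (-1 : ℚ) ^ (p + 1) + (3/2) * (-1 : ℚ) ^ (q + 1)
        + (1/2) * (-1 : ℚ) ^ (p + 1 + (q + 1))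
        + 2 * (-1 : ℚ) ^ (q + 1 + r) + 2 * (-1 : ℚ) ^ r + 2 * (-1 : ℚ) ^ (p + 1 + r)
        + 2 * (-1 : ℚ) ^ (p + 1 + (q + 1) + r) := by
  induction p using Nat.twoStepInduction with
  | more p ih _ => rw [dMat_p, ih]; ring
  | zero =>
    induction q using Nat.twoStepInduction with
    | more q ih _ => rw [dMat_q, ih]; ring
    | zero =>
      induction r using Nat.twoStepInduction with
      | more r ih _ => rw [dMat_r, ih]; ring
      | zero => decide +kernel
      | one => decide +kernel
    | one =>
      induction r using Nat.twoStepInduction with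
      | more r ih _ => rw [dMat_r, ih]; ring
      | zero => decide +kernel
      | one => decide +kernel
  | one =>
    induction q using Nat.twoStepInduction with
    | more q ih _ => rw [dMat_q, ih]; ring
    | zero =>
      induction r using Nat.twoStepInduction with
      | more r ih _ => rw [dMat_r, ih]; ring
      | zero => decide +kernel
      | one => decide +kernel
    | one =>
      induction r using Nat.twoStepInduction with
      | more r ih _ => rw [dMat_r, ih]; ring
      | zero => decide +kernel
      | one => decide +kernel

/-- The labelling of the vertices of `d(p+1,q+1,r)`. -/
def label (p q r : ℕ) : (((Fin 2 ⊕ Fin p) ⊕ Fin q) ⊕ Fin r) → Fin (p + 1 + (q + 1) + r)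
  | .inl (.inl (.inl i)) => ⟨if i = 0 then 0 else p + 1, by split_ifs <;> omega⟩
  | .inl (.inl (.inr i)) => ⟨i.val + 1, by omega⟩
  | .inl (.inr i) => ⟨p + 2 + i.val, by omega⟩
  | .inr i => ⟨p + 1 + (q + 1) + i.val, by omega⟩

theorem label_bij (p q r : ℕ) : Function.Bijective (label p q r) := by
  rw [Fintype.bijective_iff_injective_and_card]
  constructor
  · rintro (((i | i) | i) | i) (((j | j) | j) | j) h
    all_goals try fin_cases i
    all_goals try fin_cases j
    all_goals
      have h' := congrArg Fin.val h
      simp [label] at h'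
    all_goals first
      | rfl
      | (exfalso; omega)
      | exact congrArg (fun t => Sum.inl (Sum.inl (Sum.inr t))) (Fin.ext (by omega))
      | exact congrArg (fun t => Sum.inl (Sum.inr t)) (Fin.ext (by omega))
      | exact congrArg (fun t => Sum.inr t) (Fin.ext (by omega))
  · simp
    ring

theorem label_adj (p q r : ℕ) (hp : 2 ≤ p) (hq : 2 ≤ q) (hr : 1 ≤ r) (x y) :
    (if (dGraph (p + 1) (q + 1) r).Adj (label p q r x) (label p q r y) then (1 : ℚ) else 0)
      = dMat 0 p q r x y := by
  have hp' : p ≠ 0 := by omega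
  have hq' : q ≠ 0 := by omega
  have hr' : r ≠ 0 := by omega
  rcases x with ((i | i) | i) | i <;> rcases y with ((j | j) | j) | j
  all_goals
    try fin_cases i
    try fin_cases j
  all_goals
    simp only [label, dGraph, SimpleGraph.fromRel_adj, ne_eq, dMat, attach, base, Fin.ext_iff,
      hp', hq', hr', false_and, if_false, add_zero, zero_add]
  all_goals simp
  all_goals grind

theorem dMat_sum (p q r : ℕ) (x) :
    2 - ∑ y, dMat 0 p q r x y + dMat 0 p q r x x = dMat (-1) p q r x x := by
  unfold dMat
  rcases x with ((i | i) | i) | i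
  · rw [attach_sum_inl, attach_sum_inl, attach_sum_inl]
    fin_cases i <;> simp [attach, base] <;> ring
  · rw [attach_sum_inl, attach_sum_inl, attach_sum_inr]
    simp [attach]
  · rw [attach_sum_inl, attach_sum_inr]
    simp [attach]
  · rw [attach_sum_inr]
    simp [attach]

theorem dMat_off (p q r : ℕ) (x y) (h : x ≠ y) :
    dMat 0 p q r x y = dMat (-1) p q r x y := by
  unfold dMat
  rcases x with ((i | i) | i) | i <;> rcases y with ((j | j) | j) | j <;>
    simp [attach, base]
  intro h'
  exact absurd (by rw [h']) h

theorem lapPerm_eq {V : Type} [Fintype V] [i : DecidableEq V] (G : SimpleGraph V) :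
    lapPermAtTwo G = Matrix.permanent (Matrix.of fun v w : V => (if v = w then (2 : ℚ) else 0)
      - ((if v = w then (G.degree v : ℚ) else 0) - (if G.Adj v w then (1 : ℚ) else 0))) := by
  have hi : i = fun a b => Classical.propDecidable (a = b) := Subsingleton.elim _ _
  subst hi
  unfold lapPermAtTwo
  refine congrArg Matrix.permanent ?_
  funext v w
  simp only [Matrix.sub_apply, SimpleGraph.lapMatrix, SimpleGraph.degMatrix,
    Matrix.diagonal_apply, SimpleGraph.adjMatrix_apply, Matrix.of_apply]

end helpers

/-- **Lemma 3.1.** The value of the Laplacian permanental polynomial of `d(p,q,r)` at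
`x = 2`. -/
theorem lapPermAtTwo_dGraph
    (p q r : ℕ) (hp : 3 ≤ p) (hq : 3 ≤ q) (hr : 1 ≤ r) :
    lapPermAtTwo (dGraph p q r) =
      9/2 + (3/2) * (-1 : ℚ) ^ p + (3/2) * (-1 : ℚ) ^ q + (1/2) * (-1 : ℚ) ^ (p + q)
        + 2 * (-1 : ℚ) ^ (q + r) + 2 * (-1 : ℚ) ^ r + 2 * (-1 : ℚ) ^ (p + r)
        + 2 * (-1 : ℚ) ^ (p + q + r) := by
  obtain ⟨p, rfl⟩ : ∃ k, p = k + 1 := ⟨p - 1, by omega⟩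
  obtain ⟨q, rfl⟩ : ∃ k, q = k + 1 := ⟨q - 1, by omega⟩
  rw [← dMat_value]
  rw [lapPerm_eq, ← perm_reindex (Equiv.ofBijective _ (label_bij p q r))]
  refine congrArg Matrix.permanent ?_
  have hadj := label_adj p q r (by omega) (by omega) hr
  have hdeg : ∀ x, ((dGraph (p + 1) (q + 1) r).degree (label p q r x) : ℚ)
      = ∑ y, dMat 0 p q r x y := by
    intro x
    simp only [← hadj]
    rw [(label_bij p q r).sum_comp
      (fun z => if (dGraph (p + 1) (q + 1) r).Adj (label p q r x) z then (1 : ℚ) else 0)]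
    rw [Finset.sum_boole, ← SimpleGraph.card_neighborFinset_eq_degree,
      SimpleGraph.neighborFinset_eq_filter]
  funext x y
  have hxy := hadj x y
  simp only [Matrix.submatrix_apply, Matrix.of_apply, Equiv.ofBijective_apply, (label_bij p q r).1.eq_iff]
  rw [hxy]
  by_cases h : x = y
  · subst h
    rw [← dMat_sum, if_pos rfl, if_pos rfl, hdeg]
    ring
  · rw [← dMat_off _ _ _ _ _ h, if_neg h, if_neg h]
    ring
end
end
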